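/- Let p, n ∈ ℤ⁺ with n ≥ 2, let α ≥ 4 and K > 0, and let 1 ≤ s ≤ p. For any ε ∈ (0,1) there exist constants C₁, C₂, C₃ > 0 depending only on α, K and ε such that the median-of-means test φ_{P,sparse}^{MoM} := 1{max_{t∈T} A_{t,a}^{MoM}/r_t > 1} with a = C₁((p/s)^{1/α} + s^{−1/2}·log^{1/2}(log(8n))), r_t = C₂(s(p/s)^{2/α}·1{t=1} + √s·G_t·1{t>1}), G_t = min(t, Δ)/2 and Δ = 2^{4+⌈log₂ log log(8n)⌉} satisfies R_{P_{α,K}^⊗}(ρ, φ_{P,sparse}^{MoM}) ≤ ε whenever ρ² ≥ C₃·s·((p/s)^{2/α} + log log(8n)). -/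

import Mathlib

open MeasureTheory
open scoped Classical

namespace ChangePoint

noncomputable section

/-- The `i`-th column (0-based) of the data matrix, with out-of-range guard. -/
def col (p n : ℕ) (X : Fin n → Fin p → ℝ) (i : ℕ) : Fin p → ℝ :=
  if h : i < n then X ⟨i, h⟩ else 0

/-- ℓ₀-"norm": the number of nonzero coordinates. -/
def l0 (p : ℕ) (v : Fin p → ℝ) : ℕ :=
  (Finset.univ.filter fun j : Fin p => v j ≠ 0).card

/-- Squared Euclidean norm on `ℝ^p`. -/
def sqnorm (p : ℕ) (v : Fin p → ℝ) : ℝ := ∑ j, v j ^ 2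

/-- The iterated logarithm `log log (8 n)`. -/
def LL (n : ℕ) : ℝ := Real.log (Real.log (8 * n))

/-- The sub-Weibull class `𝒢_{α,K}` of distributions on `ℝ`:
mean `0`, variance `1` and `𝔼 exp (|W/K|^α) ≤ 2`. -/
def memG (α K : ℝ) (ν : Measure ℝ) : Prop :=
  IsProbabilityMeasure ν ∧ Integrable id ν ∧ (∫ x, x ∂ν) = 0 ∧
    (∫⁻ x, ENNReal.ofReal (x ^ 2) ∂ν) = 1 ∧
    (∫⁻ x, ENNReal.ofReal (Real.exp (|x / K| ^ α)) ∂ν) ≤ 2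

/-- The polynomially-tailed class `𝒫_{α,K}` of distributions on `ℝ`:
mean `0`, variance `1` and `𝔼 |W/K|^α ≤ 1`. -/
def memP (α K : ℝ) (ν : Measure ℝ) : Prop :=
  IsProbabilityMeasure ν ∧ Integrable id ν ∧ (∫ x, x ∂ν) = 0 ∧
    (∫⁻ x, ENNReal.ofReal (x ^ 2) ∂ν) = 1 ∧
    (∫⁻ x, ENNReal.ofReal (|x / K| ^ α) ∂ν) ≤ 1

/-- `P` is the joint law on `ℝ^{p×n}` of `p·n` independent entries with marginal laws `ν t j`
(characterised on measurable rectangles). -/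
def IsEntrywiseProduct (p n : ℕ) (P : Measure (Fin n → Fin p → ℝ))
    (ν : Fin n → Fin p → Measure ℝ) : Prop :=
  IsProbabilityMeasure P ∧
    ∀ s : Fin n → Fin p → Set ℝ, (∀ t j, MeasurableSet (s t j)) →
      P {x | ∀ t j, x t j ∈ s t j} = ∏ t, ∏ j, ν t j (s t j)

/-- The class `𝒢_{α,K}^⊗` of noise distributions. -/
def Gclass (p n : ℕ) (α K : ℝ) : Set (Measure (Fin n → Fin p → ℝ)) :=
  {P | ∃ ν : Fin n → Fin p → Measure ℝ, (∀ t j, memG α K (ν t j)) ∧ IsEntrywiseProduct p n P ν}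

/-- The class `𝒫_{α,K}^⊗` of noise distributions. -/
def Pclass (p n : ℕ) (α K : ℝ) : Set (Measure (Fin n → Fin p → ℝ)) :=
  {P | ∃ ν : Fin n → Fin p → Measure ℝ, (∀ t j, memP α K (ν t j)) ∧ IsEntrywiseProduct p n P ν}

/-- The null parameter space `Θ₀(p,n)`: constant signal. -/
def Theta0 (p n : ℕ) : Set (Fin n → Fin p → ℝ) :=
  {θ | ∃ μ : Fin p → ℝ, ∀ t, θ t = μ}

/-- `Θ^{(t₀)}(p,n,s,ρ)`: a single mean change at (1-based) time `t0` of sparsity `s` and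
normalized signal strength at least `ρ`. -/
def ThetaAt (p n t0 s : ℕ) (ρ : ℝ) : Set (Fin n → Fin p → ℝ) :=
  {θ | ∃ μ₁ μ₂ : Fin p → ℝ,
    (∀ t : Fin n, (t : ℕ) < t0 → θ t = μ₁) ∧
    (∀ t : Fin n, t0 ≤ (t : ℕ) → θ t = μ₂) ∧
    l0 p (fun j => μ₁ j - μ₂ j) ≤ s ∧
    ρ ^ 2 ≤ (t0 : ℝ) * ((n : ℝ) - (t0 : ℝ)) / (n : ℝ) * sqnorm p (fun j => μ₁ j - μ₂ j)}

/-- The single-change-point alternative `Θ(p,n,s,ρ)`. -/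
def Theta1 (p n s : ℕ) (ρ : ℝ) : Set (Fin n → Fin p → ℝ) :=
  ⋃ t0 ∈ Finset.Icc 1 (n - 1), ThetaAt p n t0 s ρ

/-- A (randomized-free) test: a measurable `{0,1}`-valued function of the data. -/
def IsTest (p n : ℕ) (φ : (Fin n → Fin p → ℝ) → ℝ) : Prop :=
  Measurable φ ∧ ∀ x, φ x = 0 ∨ φ x = 1

/-- The worst-case testing error of the test `φ` for null `Θ₀(p,n)` against the
alternative `Θalt`, over the noise class `Q`. -/
def risk (p n : ℕ) (Q : Set (Measure (Fin n → Fin p → ℝ)))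
    (Θalt : Set (Fin n → Fin p → ℝ)) (φ : (Fin n → Fin p → ℝ) → ℝ) : ℝ :=
  (⨆ P ∈ Q, ⨆ θ ∈ Theta0 p n, ∫ E, φ (θ + E) ∂P) +
  (⨆ P ∈ Q, ⨆ θ ∈ Θalt, ∫ E, (1 - φ (θ + E)) ∂P)

/-- The dyadic grid `𝒯 = {1,2,4,…,2^{⌊log₂(n/2)⌋}}`. -/
def Tgrid (n : ℕ) : Finset ℕ :=
  (Finset.range (Nat.log 2 (n / 2) + 1)).image fun k => 2 ^ k

/-- The CUSUM-type statistic `Y_t`. -/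
def Yt (p n : ℕ) (X : Fin n → Fin p → ℝ) (t : ℕ) (j : Fin p) : ℝ :=
  (∑ i ∈ Finset.range t, (col p n X i j - col p n X (n - 1 - i) j)) / Real.sqrt (2 * t)

/-- `A_t = ∑_j (Y_t(j)² − 1)`. -/
def At (p n : ℕ) (X : Fin n → Fin p → ℝ) (t : ℕ) : ℝ :=
  ∑ j, (Yt p n X t j ^ 2 - 1)

/-- The dense sub-Weibull test `φ_{𝒢,dense}` with threshold `r`. -/
def phiGdense (p n : ℕ) (r : ℝ) (X : Fin n → Fin p → ℝ) : ℝ :=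
  if ∃ t ∈ Tgrid n, r < At p n X t then 1 else 0

/-- Sample-splitting statistic `Y_{t,1}` (odd-indexed observations). -/
def Yt1 (p n : ℕ) (X : Fin n → Fin p → ℝ) (t : ℕ) (j : Fin p) : ℝ :=
  (∑ i ∈ Finset.range (t / 2), (col p n X (2 * i) j - col p n X (n - 1 - 2 * i) j)) /
    Real.sqrt t

/-- Sample-splitting statistic `Y_{t,2}` (even-indexed observations). -/
def Yt2 (p n : ℕ) (X : Fin n → Fin p → ℝ) (t : ℕ) (j : Fin p) : ℝ :=
  (∑ i ∈ Finset.range (t / 2), (col p n X (2 * i + 1) j - col p n X (n - 2 - 2 * i) j)) /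
    Real.sqrt t

/-- `Y_1 = (X_1 − X_n)/√2`. -/
def Y1 (p n : ℕ) (X : Fin n → Fin p → ℝ) (j : Fin p) : ℝ :=
  (col p n X 0 j - col p n X (n - 1) j) / Real.sqrt 2

/-- The hard-thresholded statistic `A_{t,a}`. -/
def Ata (p n : ℕ) (X : Fin n → Fin p → ℝ) (t : ℕ) (a : ℝ) : ℝ :=
  if t = 1 then ∑ j, (Y1 p n X j ^ 2 - 1) * (if a ≤ |Y1 p n X j| then 1 else 0)
  else ∑ j, (Yt1 p n X t j ^ 2 - 1) * (if a ≤ |Yt2 p n X t j| then 1 else 0)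

/-- The sparse sub-Weibull test `φ_{𝒢,sparse}` with threshold parameters `a, r, r₁`. -/
def phiGsparse (p n : ℕ) (a r r₁ : ℝ) (X : Fin n → Fin p → ℝ) : ℝ :=
  if (∃ t ∈ Tgrid n, t ≠ 1 ∧ r < Ata p n X t a) ∨ r₁ < Ata p n X 1 a then 1 else 0

/-- The median of a list of reals: its `⌈m/2⌉`-th smallest element. -/
def median (l : List ℝ) : ℝ :=
  (l.insertionSort (· ≤ ·)).getD ((l.length + 1) / 2 - 1) 0

/-- `Z_i = (X_i − X_{n+1−i})/√2` (0-based index `i`). -/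
def Zb (p n : ℕ) (X : Fin n → Fin p → ℝ) (i : ℕ) (j : Fin p) : ℝ :=
  (col p n X i j - col p n X (n - 1 - i) j) / Real.sqrt 2

/-- Mean of the `g`-th (0-based) of `G` consecutive equal-size groups of `Z_1,…,Z_t`. -/
def groupMean (p n : ℕ) (X : Fin n → Fin p → ℝ) (t G g : ℕ) (j : Fin p) : ℝ :=
  (∑ i ∈ Finset.range (t / G), Zb p n X (g * (t / G) + i) j) / ((t / G : ℕ) : ℝ)

/-- The median-of-means statistic `A_t^{MoM}` with `G` groups. -/
def AMoM (p n : ℕ) (X : Fin n → Fin p → ℝ) (t G : ℕ) : ℝ :=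
  (t : ℝ) * median (List.ofFn fun g : Fin G =>
    ∑ j, (groupMean p n X t G (g : ℕ) j ^ 2 - (G : ℝ) / (t : ℝ)))

/-- `Δ = 2^{3+⌈log₂ log log (8n)⌉}`. -/
def DeltaDense (n : ℕ) : ℕ := 2 ^ (3 + (Int.ceil (Real.logb 2 (LL n))).toNat)

/-- The dense median-of-means test `φ_{𝒫,dense}`. -/
def phiPdense (p n : ℕ) (α C₁ : ℝ) (X : Fin n → Fin p → ℝ) : ℝ :=
  if ∃ t ∈ Tgrid n,
      1 < AMoM p n X t (min t (DeltaDense n)) /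
        (C₁ * (p : ℝ) ^ max ((1 : ℝ) / 2) (2 / α) * ((min t (DeltaDense n) : ℕ) : ℝ))
  then 1 else 0

/-- `Δ = 2^{4+⌈log₂ log log (8n)⌉}`. -/
def DeltaSparse (n : ℕ) : ℕ := 2 ^ (4 + (Int.ceil (Real.logb 2 (LL n))).toNat)

/-- Mean of the `g`-th (0-based) of `G` consecutive equal-size groups of the odd-indexed
`Z_1, Z_3, …, Z_{t−1}`. -/
def groupMeanOdd (p n : ℕ) (X : Fin n → Fin p → ℝ) (t G g : ℕ) (j : Fin p) : ℝ :=
  (∑ i ∈ Finset.range (t / (2 * G)), Zb p n X (2 * (g * (t / (2 * G)) + i)) j) /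
    ((t / (2 * G) : ℕ) : ℝ)

/-- The hard-thresholded median-of-means statistic `A_{t,a}^{MoM}` with `G` groups. -/
def AMoMa (p n : ℕ) (X : Fin n → Fin p → ℝ) (t G : ℕ) (a : ℝ) : ℝ :=
  if t = 1 then ∑ j, (Zb p n X 0 j ^ 2 - 1) * (if a ≤ |Zb p n X 0 j| then 1 else 0)
  else ((t : ℝ) / 2) * median (List.ofFn fun g : Fin G =>
    ∑ j, (groupMeanOdd p n X t G (g : ℕ) j ^ 2 - 2 * (G : ℝ) / (t : ℝ)) *
      (if a ≤ |Yt2 p n X t j| then 1 else 0))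

/-- The sparse median-of-means test `φ_{𝒫,sparse}^{MoM}`. -/
def phiPsparseMoM (p n s : ℕ) (α C₁ C₂ : ℝ) (X : Fin n → Fin p → ℝ) : ℝ :=
  if ∃ t ∈ Tgrid n,
      1 < AMoMa p n X t (min t (DeltaSparse n) / 2)
            (C₁ * (((p : ℝ) / (s : ℝ)) ^ ((1 : ℝ) / α) +
              ((s : ℝ) ^ (-(1 : ℝ) / 2)) * Real.sqrt (LL n))) /
          (C₂ * (if t = 1 then (s : ℝ) * ((p : ℝ) / (s : ℝ)) ^ ((2 : ℝ) / α)
                 else Real.sqrt (s : ℝ) * ((min t (DeltaSparse n) / 2 : ℕ) : ℝ)))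
  then 1 else 0

/-- Condition RSM for `(α, K)` with constants `C₁, C₂`: statistical guarantee for a family
of (measurable) robust sparse mean estimators. -/
def CondRSM (p s : ℕ) (α K C₁ C₂ : ℝ)
    (est : (m : ℕ) → (Fin m → Fin p → ℝ) → ℝ → Fin p → ℝ) : Prop :=
  (∀ m : ℕ, Measurable fun Wη : (Fin m → Fin p → ℝ) × ℝ => est m Wη.1 Wη.2) ∧
  ∀ (m : ℕ) (μW : Fin p → ℝ) (ν : Fin m → Measure (Fin p → ℝ))
    (P : Measure (Fin m → Fin p → ℝ)) (η : ℝ),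
    0 < η → η < 1 → l0 p μW ≤ s →
    (∀ i, IsProbabilityMeasure (ν i)) →
    (∀ i j, Integrable (fun w => w j) (ν i) ∧ (∫ w, w j ∂ν i) = μW j) →
    (∀ i j k, Integrable (fun w => (w j - μW j) * (w k - μW k)) (ν i) ∧
      (∫ w, (w j - μW j) * (w k - μW k) ∂ν i) = if j = k then 1 else 0) →
    (∀ i j, (∫⁻ w, ENNReal.ofReal (|w j - μW j| ^ α) ∂ν i) ≤
      ENNReal.ofReal ((Real.sqrt 2 * K) ^ α)) →
    IsProbabilityMeasure P →
    (∀ S : Fin m → Set (Fin p → ℝ), (∀ i, MeasurableSet (S i)) →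
      P {W | ∀ i, W i ∈ S i} = ∏ i, ν i (S i)) →
    C₁ * ((s : ℝ) * Real.log (Real.exp 1 * (p : ℝ) / (s : ℝ)) + Real.log (1 / η)) ≤ (m : ℝ) →
    ENNReal.ofReal (1 - η) ≤
      P {W | Real.sqrt (sqnorm p fun j => est m W η j - μW j) ≤
        Real.sqrt C₂ * (Real.sqrt ((s : ℝ) * Real.log (Real.exp 1 * (p : ℝ) / (s : ℝ)) / (m : ℝ)) +
          Real.sqrt (Real.log (1 / η) / (m : ℝ)))}

/-- `Δ̃₁ = C₅ (s log(ep/s) + log(16/ε))`. -/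
def rsmDelta1 (p s : ℕ) (ε C₅ : ℝ) : ℝ :=
  C₅ * ((s : ℝ) * Real.log (Real.exp 1 * (p : ℝ) / (s : ℝ)) + Real.log (16 / ε))

/-- `Δ̃₂ = C₅ (s log(ep/s) + log(16 log(2n)/ε))`. -/
def rsmDelta2 (p s n : ℕ) (ε C₅ : ℝ) : ℝ :=
  C₅ * ((s : ℝ) * Real.log (Real.exp 1 * (p : ℝ) / (s : ℝ)) +
    Real.log (16 * Real.log (2 * (n : ℝ)) / ε))

/-- `a = C₃ ((p/s)^{1/α} + s^{−1/2} log^{1/2}(log Δ̃₁))`. -/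
def rsmA (p s : ℕ) (α ε C₃ C₅ : ℝ) : ℝ :=
  C₃ * (((p : ℝ) / (s : ℝ)) ^ ((1 : ℝ) / α) +
    ((s : ℝ) ^ (-(1 : ℝ) / 2)) * Real.sqrt (Real.log (Real.log (rsmDelta1 p s ε C₅))))

/-- The sparse test `φ^{RSM}_{𝒫,sparse}` built from a robust sparse mean estimator `est`. -/
def phiRSM (p n s : ℕ) (est : (m : ℕ) → (Fin m → Fin p → ℝ) → ℝ → Fin p → ℝ)
    (α ε C₃ C₄ C₅ C₆ : ℝ) (X : Fin n → Fin p → ℝ) : ℝ :=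
  if (∃ t ∈ Tgrid n, (t : ℝ) ≤ rsmDelta1 p s ε C₅ ∧
        1 < Ata p n X t (rsmA p s α ε C₃ C₅) /
          (C₄ * (if t = 1 then (s : ℝ) * ((p : ℝ) / (s : ℝ)) ^ ((2 : ℝ) / α)
                 else Real.sqrt ((s : ℝ) * Real.log (rsmDelta1 p s ε C₅))))) ∨
     (∃ t ∈ Tgrid n, rsmDelta1 p s ε C₅ < (t : ℝ) ∧
        1 < (t : ℝ) * sqnorm p (est t (fun i : Fin t => fun j => Zb p n X (i : ℕ) j)
              (Real.exp ((s : ℝ) * Real.log (Real.exp 1 * (p : ℝ) / (s : ℝ)) -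
                min (t : ℝ) (rsmDelta2 p s n ε C₅) / C₅))) /
          (C₆ * min (t : ℝ) (rsmDelta2 p s n ε C₅)))
  then 1 else 0

/-- The multiple-change-point alternative `Θ_multi(p,n,ρ)`. -/
def ThetaMulti (p n : ℕ) (ρ : ℝ) : Set (Fin n → Fin p → ℝ) :=
  {θ | ∃ k : ℕ, 1 ≤ k ∧ ∃ τ : ℕ → ℕ, ∃ μ : ℕ → Fin p → ℝ,
    τ 0 = 0 ∧ τ (k + 1) = n ∧ (∀ i ≤ k, τ i < τ (i + 1)) ∧
    (∀ i, 1 ≤ i → i ≤ k + 1 →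
      ∀ t : Fin n, τ (i - 1) ≤ (t : ℕ) → (t : ℕ) < τ i → θ t = μ i) ∧
    ∃ i, 1 ≤ i ∧ i ≤ k ∧
      4 * Real.log (n : ℝ) ≤ ((min (τ i - τ (i - 1)) (τ (i + 1) - τ i) : ℕ) : ℝ) ∧
      ρ ^ 2 ≤ sqnorm p (fun j => μ (i + 1) j - μ i j) *
        ((min (τ i - τ (i - 1)) (τ (i + 1) - τ i) : ℕ) : ℝ)}

/-- Membership in the temporal-dependence class `𝒫_Temp`: independent rows, entrywise
`𝒫_{α,K}` marginals, and exponentially decaying interlaced α-mixing coefficients. -/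
def memPTemp (p n : ℕ) (α K c₁ c₂ : ℝ) (P : Measure (Fin n → Fin p → ℝ)) : Prop :=
  IsProbabilityMeasure P ∧
  (∀ s : Fin p → Set (Fin n → ℝ), (∀ j, MeasurableSet (s j)) →
    P {x | ∀ j, (fun t => x t j) ∈ s j} = ∏ j, P {x | (fun t => x t j) ∈ s j}) ∧
  (∀ t j, memP α K (P.map fun x => x t j)) ∧
  (∀ i : ℕ, 1 ≤ i → i ≤ n - 1 →
    ∀ S T : Set (Fin n),
      (∀ s' ∈ S, ∀ t' ∈ T, (i : ℤ) ≤ |((s' : ℕ) : ℤ) - ((t' : ℕ) : ℤ)|) →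
      ∀ A B : Set (Fin n → Fin p → ℝ),
        MeasurableSet[MeasurableSpace.comap (fun x (t : S) => x t.1) inferInstance] A →
        MeasurableSet[MeasurableSpace.comap (fun x (t : T) => x t.1) inferInstance] B →
        |(P (A ∩ B)).toReal - (P A).toReal * (P B).toReal| ≤ c₁ * Real.exp (-c₂ * (i : ℝ)))

/-- The class `𝒲_α` of distributions on `ℝ^p`: centered with `𝔼|⟨W,v⟩|^α ≤ 1` for
every unit vector `v`. -/
def memW (p : ℕ) (α : ℝ) (ν : Measure (Fin p → ℝ)) : Prop :=
  IsProbabilityMeasure ν ∧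
  (∀ j, Integrable (fun w => w j) ν ∧ (∫ w, w j ∂ν) = 0) ∧
  ∀ v : Fin p → ℝ, sqnorm p v = 1 →
    (∫⁻ w, ENNReal.ofReal (|∑ j, w j * v j| ^ α) ∂ν) ≤ 1

/-- The class `𝒲_α^⊗`: independent columns with distributions in `𝒲_α`. -/
def Wclass (p n : ℕ) (α : ℝ) : Set (Measure (Fin n → Fin p → ℝ)) :=
  {P | ∃ ν : Fin n → Measure (Fin p → ℝ), (∀ t, memW p α (ν t)) ∧
    IsProbabilityMeasure P ∧
    ∀ s : Fin n → Set (Fin p → ℝ), (∀ t, MeasurableSet (s t)) →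
      P {x | ∀ t, x t ∈ s t} = ∏ t, ν t (s t)}

/-- The alternative `⋃_{t₀=1}^{n−1} Θ(p,n,ρ_{t₀})` for a location-dependent signal
strength sequence `ρ`. -/
def ThetaSeq (p n : ℕ) (ρ : ℕ → ℝ) : Set (Fin n → Fin p → ℝ) :=
  ⋃ t0 ∈ Finset.Icc 1 (n - 1),
    {θ | ∃ μ₁ μ₂ : Fin p → ℝ,
      (∀ t : Fin n, (t : ℕ) < t0 → θ t = μ₁) ∧
      (∀ t : Fin n, t0 ≤ (t : ℕ) → θ t = μ₂) ∧
      (ρ t0) ^ 2 ≤ sqnorm p (fun j => μ₁ j - μ₂ j)}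

/-- The boundary-restricted alternative `Θ_res(p,n,s,ρ)`. -/
def ThetaRes (p n s : ℕ) (ρ tres : ℝ) : Set (Fin n → Fin p → ℝ) :=
  {θ | ∃ t0 : ℕ, tres + 1 ≤ (t0 : ℝ) ∧ (t0 : ℝ) ≤ (n : ℝ) - tres ∧ θ ∈ ThetaAt p n t0 s ρ}

/-- `t^res = 32 (log (e² p / s) + s^{−1} log log (8n))`. -/
def tRes (p n s : ℕ) : ℝ :=
  32 * (Real.log (Real.exp 1 ^ 2 * (p : ℝ) / (s : ℝ)) + LL n / (s : ℝ))

end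

theorem countP_ofFn_eq {G : ℕ} (l : Fin G → ℝ) (q : ℝ → Prop) [DecidablePred q] :
    (List.ofFn l).countP (fun x => decide (q x)) =
      (Finset.univ.filter fun g : Fin G => q (l g)).card := by
  rw [List.ofFn_eq_map, List.countP_map, List.countP_eq_length_filter]
  rw [← List.toFinset_card_of_nodup ((List.nodup_finRange G).filter _)]
  congr 1
  ext g
  simp

theorem card_lt_of_lt_median {G : ℕ} (hG : 1 ≤ G) (l : Fin G → ℝ) (c : ℝ)
    (h : c < median (List.ofFn l)) :
    G ≤ 2 * (Finset.univ.filter fun g : Fin G => c < l g).card := by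
  rw [← countP_ofFn_eq l (fun x => c < x),
    ← (List.perm_insertionSort (· ≤ ·) (List.ofFn l)).countP_eq]
  unfold median at h
  have hs := List.pairwise_insertionSort (· ≤ · : ℝ → ℝ → Prop) (List.ofFn l)
  have hlen := List.length_insertionSort (· ≤ · : ℝ → ℝ → Prop) (List.ofFn l)
  generalize List.insertionSort (· ≤ ·) (List.ofFn l) = L at *
  simp only [List.length_ofFn] at hlen h
  have hk : (G + 1) / 2 - 1 < L.length := by omega
  rw [List.getD_eq_getElem _ _ hk] at h
  have h1 : (L.drop ((G + 1) / 2 - 1)).countP (fun x => decide (c < x)) =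
      (L.drop ((G + 1) / 2 - 1)).length := by
    rw [List.countP_eq_length]
    intro x hx
    obtain ⟨i, hi, rfl⟩ := List.mem_drop_iff_getElem.1 hx
    have : L[(G + 1) / 2 - 1] ≤ L[(G + 1) / 2 - 1 + i] := by
      rcases Nat.eq_zero_or_pos i with rfl | hi0
      · simp
      · exact List.pairwise_iff_getElem.1 hs _ _ _ _ (by omega)
    simpa using lt_of_lt_of_le h this
  have h2 := (List.drop_sublist ((G + 1) / 2 - 1) L).countP_le (p := fun x => decide (c < x))
  rw [h1, List.length_drop] at h2
  omega

theorem card_le_of_median_le {G : ℕ} (hG : 1 ≤ G) (l : Fin G → ℝ) (c : ℝ)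
    (h : median (List.ofFn l) ≤ c) :
    G ≤ 2 * (Finset.univ.filter fun g : Fin G => l g ≤ c).card := by
  rw [← countP_ofFn_eq l (fun x => x ≤ c),
    ← (List.perm_insertionSort (· ≤ ·) (List.ofFn l)).countP_eq]
  unfold median at h
  have hs := List.pairwise_insertionSort (· ≤ · : ℝ → ℝ → Prop) (List.ofFn l)
  have hlen := List.length_insertionSort (· ≤ · : ℝ → ℝ → Prop) (List.ofFn l)
  generalize List.insertionSort (· ≤ ·) (List.ofFn l) = L at *
  simp only [List.length_ofFn] at hlen h
  have hk : (G + 1) / 2 - 1 < L.length := by omega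
  rw [List.getD_eq_getElem _ _ hk] at h
  have h1 : (L.take ((G + 1) / 2)).countP (fun x => decide (x ≤ c)) =
      (L.take ((G + 1) / 2)).length := by
    rw [List.countP_eq_length]
    intro x hx
    obtain ⟨i, hi, rfl⟩ := List.mem_take_iff_getElem.1 hx
    have : L[i] ≤ L[(G + 1) / 2 - 1] := by
      rcases (by omega : i = (G + 1) / 2 - 1 ∨ i < (G + 1) / 2 - 1) with rfl | hi0
      · simp
      · exact List.pairwise_iff_getElem.1 hs _ _ _ _ hi0
    simpa using this.trans h
  have h2 := (List.take_sublist ((G + 1) / 2) L).countP_le (p := fun x => decide (x ≤ c))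
  rw [h1, List.length_take] at h2
  omega

theorem iIndepFun_of_color {Ω ι κ γ : Type*} [MeasurableSpace Ω] [MeasurableSpace γ]
    {μ : Measure Ω} (f : ι → Ω → ℝ) (hf : ∀ i, Measurable (f i))
    (h : ProbabilityTheory.iIndepFun f μ) (c : ι → κ) (S : κ → Finset ι)
    (hS : ∀ k, ∀ i ∈ S k, c i = k) (φ : κ → (ι → ℝ) → γ) (hφ : ∀ k, Measurable (φ k))
    (hdep : ∀ k x y, (∀ i ∈ S k, x i = y i) → φ k x = φ k y) :
    ProbabilityTheory.iIndepFun (fun k ω => φ k (fun i => f i ω)) μ := by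
  have : IsProbabilityMeasure μ := h.isProbabilityMeasure
  rw [ProbabilityTheory.iIndepFun_iff_measure_inter_preimage_eq_mul]
  intro T sets hsets
  let ext (A : Finset ι) (x : A → ℝ) (i : ι) : ℝ := if hi : i ∈ A then x ⟨i, hi⟩ else 0
  have hext : ∀ A, Measurable (ext A) := by
    intro A
    refine measurable_pi_lambda _ fun i => ?_
    by_cases hi : i ∈ A
    · simpa only [ext, hi, dite_true] using measurable_pi_apply (⟨i, hi⟩ : A)
    · simpa only [ext, hi, dite_false] using measurable_const
  have key : ∀ A : Finset ι, ∀ k, S k ⊆ A → ∀ ω,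
      φ k (fun i => f i ω) = φ k (ext A (fun i : A => f i ω)) := by
    intro A k hA ω
    refine hdep k _ _ fun i hi => ?_
    simp [ext, hA hi]
  induction T using Finset.induction_on with
  | empty => simp
  | insert k T hk ih =>
    have ih := ih fun i hi => hsets i (Finset.mem_insert_of_mem hi)
    rw [Finset.prod_insert hk, ← ih, Finset.set_biInter_insert]
    have hdisj : Disjoint (S k) (T.biUnion S) := by
      rw [Finset.disjoint_left]
      intro i hi hi'
      obtain ⟨k', hk', hik'⟩ := Finset.mem_biUnion.1 hi'
      have : k = k' := (hS k i hi).symm.trans (hS k' i hik')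
      exact hk (this ▸ hk')
    have hind := h.indepFun_finset (S k) (T.biUnion S) hdisj hf
    have := hind.measure_inter_preimage_eq_mul ((fun x => φ k (ext _ x)) ⁻¹' sets k)
      (⋂ k' ∈ T, (fun x => φ k' (ext _ x)) ⁻¹' sets k')
      (((hφ k).comp (hext _)) (hsets k (Finset.mem_insert_self k T)))
      (Finset.measurableSet_biInter _ fun k' hk' =>
        ((hφ k').comp (hext _)) (hsets k' (Finset.mem_insert_of_mem hk')))
    convert this using 2
    · congr 1
      · ext ω
        simp [key (S k) k subset_rfl ω]
      · ext ω
        simp only [Set.mem_iInter, Set.mem_preimage]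
        refine forall₂_congr fun k' hk' => ?_
        rw [key (T.biUnion S) k' (Finset.subset_biUnion_of_mem S hk') ω]
    · congr 1
      ext ω
      simp [key (S k) k subset_rfl ω]
    · congr 1
      ext ω
      simp only [Set.mem_iInter, Set.mem_preimage]
      refine forall₂_congr fun k' hk' => ?_
      rw [key (T.biUnion S) k' (Finset.subset_biUnion_of_mem S hk') ω]

/-- If any `k` events occur simultaneously with probability at most `q ^ k`, then at least `k` of
them occur with probability at most `(N choose k) q ^ k`. -/
theorem measureReal_le_card_filter_le {Ω ι : Type*} [MeasurableSpace Ω] [Fintype ι]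
    {μ : Measure Ω} [IsProbabilityMeasure μ] (B : ι → Set Ω) (q : ℝ) (k : ℕ)
    (hB : ∀ S : Finset ι, μ.real (⋂ i ∈ S, B i) ≤ q ^ S.card) :
    μ.real {ω | k ≤ (Finset.univ.filter fun i => ω ∈ B i).card} ≤
      ((Fintype.card ι).choose k : ℝ) * q ^ k := by
  calc μ.real {ω | k ≤ (Finset.univ.filter fun i => ω ∈ B i).card}
      ≤ μ.real (⋃ S ∈ Finset.powersetCard k (Finset.univ : Finset ι), ⋂ i ∈ S, B i) := by
        refine measureReal_mono ?_ (measure_ne_top _ _)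
        intro ω hω
        obtain ⟨S, hS, hc⟩ := Finset.exists_subset_card_eq hω
        simp only [Set.mem_iUnion, Set.mem_iInter]
        exact ⟨S, Finset.mem_powersetCard.2 ⟨Finset.subset_univ _, hc⟩, fun i hi =>
          (Finset.mem_filter.1 (hS hi)).2⟩
    _ ≤ ∑ S ∈ Finset.powersetCard k (Finset.univ : Finset ι), μ.real (⋂ i ∈ S, B i) :=
        measureReal_biUnion_finset_le _ _
    _ ≤ ∑ S ∈ Finset.powersetCard k (Finset.univ : Finset ι), q ^ k :=
        Finset.sum_le_sum fun S hS => (Finset.mem_powersetCard.1 hS).2 ▸ hB S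
    _ = _ := by simp

/-- Tail of the number of occurrences of independent events of probability at most `q`. -/
theorem measureReal_le_card_filter_le_of_iIndepFun {Ω ι γ : Type*} [MeasurableSpace Ω] [Fintype ι]
    [MeasurableSpace γ] {μ : Measure Ω} (X : ι → Ω → γ)
    (h : ProbabilityTheory.iIndepFun X μ) (s : ι → Set γ) (hs : ∀ i, MeasurableSet (s i)) (q : ℝ)
    (hq : ∀ i, μ.real {ω | X i ω ∈ s i} ≤ q) (k : ℕ) :
    μ.real {ω | k ≤ (Finset.univ.filter fun i => X i ω ∈ s i).card} ≤
      ((Fintype.card ι).choose k : ℝ) * q ^ k := by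
  have : IsProbabilityMeasure μ := h.isProbabilityMeasure
  refine ChangePoint.measureReal_le_card_filter_le (fun i => X i ⁻¹' s i) q k fun S => ?_
  rw [measureReal_def, h.measure_inter_preimage_eq_mul S (fun i _ => hs i), ENNReal.toReal_prod]
  calc _ ≤ ∏ i ∈ S, q := Finset.prod_le_prod (fun _ _ => ENNReal.toReal_nonneg) fun i _ => hq i
    _ = _ := by simp

/-- A real random variable with mean `0`, variance `1` and `α`-th absolute moment at most `M`. -/
structure Standardized {Ω : Type*} [MeasurableSpace Ω] (μ : Measure Ω) (X : Ω → ℝ) (α M : ℝ) :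
    Prop where
  meas : Measurable X
  int_alpha : Integrable (fun ω => |X ω| ^ α) μ
  mean : ∫ ω, X ω ∂μ = 0
  sq : ∫ ω, X ω ^ 2 ∂μ = 1
  alpha : ∫ ω, |X ω| ^ α ∂μ ≤ M

theorem Standardized.neg {Ω : Type*} [MeasurableSpace Ω] {μ : Measure Ω} {X : Ω → ℝ} {α M : ℝ}
    (h : Standardized μ X α M) :
    Standardized μ (fun ω => -X ω) α M where
  meas := h.meas.neg
  int_alpha := by simpa using h.int_alpha
  mean := by rw [integral_neg, h.mean, neg_zero]
  sq := by simpa using h.sq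
  alpha := by simpa using h.alpha

theorem abs_pow_le_one_add_rpow (x α : ℝ) (k : ℕ) (hk : (k : ℝ) ≤ α) :
    |x| ^ k ≤ 1 + |x| ^ α := by
  have h0 : 0 ≤ |x| ^ α := Real.rpow_nonneg (abs_nonneg x) α
  rcases le_total |x| 1 with h | h
  · have := pow_le_one₀ (n := k) (abs_nonneg x) h
    linarith
  · have := Real.rpow_le_rpow_of_exponent_le h hk
    rw [Real.rpow_natCast] at this
    linarith

namespace Standardized
variable {Ω : Type*} [MeasurableSpace Ω] {μ : Measure Ω} [IsProbabilityMeasure μ] {X : Ω → ℝ}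
  {α M : ℝ}

theorem integrable_pow (h : Standardized μ X α M) (k : ℕ) (hk : (k : ℝ) ≤ α) :
    Integrable (fun ω => X ω ^ k) μ := by
  refine Integrable.mono' ((integrable_const (1 : ℝ)).add h.int_alpha)
    (h.meas.pow_const k).aestronglyMeasurable (ae_of_all _ fun ω => ?_)
  rw [Real.norm_eq_abs, abs_pow]
  exact abs_pow_le_one_add_rpow _ _ _ hk

theorem integrable (h : Standardized μ X α M) (hα : 1 ≤ α) : Integrable X μ := by
  simpa using h.integrable_pow 1 (by simpa using hα)

theorem integral_pow_four_le (h : Standardized μ X α M) (hα : 4 ≤ α) :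
    ∫ ω, X ω ^ 4 ∂μ ≤ 1 + M := by
  calc ∫ ω, X ω ^ 4 ∂μ ≤ ∫ ω, (1 + |X ω| ^ α) ∂μ := by
        refine integral_mono (h.integrable_pow 4 (by simpa using hα))
          ((integrable_const _).add h.int_alpha) fun ω => ?_
        have := abs_pow_le_one_add_rpow (X ω) α 4 (by simpa using hα)
        rwa [Even.pow_abs (by decide)] at this
    _ = 1 + ∫ ω, |X ω| ^ α ∂μ := by
        rw [integral_add (integrable_const _) h.int_alpha]; simp
    _ ≤ 1 + M := by linarith [h.alpha]

theorem measureReal_lt_le (h : Standardized μ X α M) (hα : 0 < α) {y : ℝ} (hy : 0 < y) :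
    μ.real {ω | y < X ω} ≤ M / y ^ α := by
  have hyα : 0 < y ^ α := Real.rpow_pos_of_pos hy α
  rw [le_div_iff₀ hyα, mul_comm]
  refine le_trans ?_ ((mul_meas_ge_le_integral_of_nonneg (ae_of_all _ fun ω =>
    Real.rpow_nonneg (abs_nonneg (X ω)) α) h.int_alpha (y ^ α)).trans h.alpha)
  refine mul_le_mul_of_nonneg_left (measureReal_mono ?_ (measure_ne_top _ _)) hyα.le
  intro ω hω
  exact Real.rpow_le_rpow hy.le ((le_of_lt hω).trans (le_abs_self _)) hα.le

end Standardized

theorem exp_le_one_add_add_mul_sq {u α : ℝ} (hα : 0 ≤ α) (hu : u ≤ α) :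
    Real.exp u ≤ 1 + u + Real.exp α * u ^ 2 := by
  have h1 : 1 ≤ Real.exp α := Real.one_le_exp hα
  rcases le_total u 0 with h | h
  · have hq := Real.quadratic_le_exp_of_nonneg (x := -u) (by linarith)
    have hp := Real.exp_pos u
    have he : Real.exp u * Real.exp (-u) = 1 := by rw [← Real.exp_add]; simp
    have h2 : Real.exp u * (1 + -u + (-u) ^ 2 / 2) ≤ 1 :=
      (mul_le_mul_of_nonneg_left hq hp.le).trans_eq he
    have h3 : 1 ≤ (1 + u + u ^ 2) * (1 + -u + (-u) ^ 2 / 2) := by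
      nlinarith [sq_nonneg u, sq_nonneg (u ^ 2), mul_nonneg (sq_nonneg u) (neg_nonneg.2 h)]
    have h4 : 0 < 1 + -u + (-u) ^ 2 / 2 := by nlinarith [sq_nonneg u]
    have h5 : Real.exp u ≤ 1 + u + u ^ 2 := le_of_mul_le_mul_right (h2.trans h3) h4
    nlinarith [sq_nonneg u]
  · have he : Real.exp u * Real.exp (-u) = 1 := by rw [← Real.exp_add]; simp
    have h2 := Real.add_one_le_exp (-u)
    have hp := Real.exp_pos u
    have h3 : Real.exp u * (1 - u) ≤ 1 := by
      rw [← he]; exact mul_le_mul_of_nonneg_left (by linarith) hp.le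
    have h4 : Real.exp u ≤ Real.exp α := Real.exp_le_exp.2 hu
    nlinarith [sq_nonneg u, mul_le_mul_of_nonneg_right h4 (sq_nonneg u)]

theorem exp_trunc_le {h y α x : ℝ} (hh : 0 < h) (hy : 0 < y) (hα : 0 < α) :
    Real.exp (h * (if x ≤ y then x else 0)) ≤
      1 + h * x + Real.exp α * h ^ 2 * x ^ 2 + Real.exp (h * y) / y ^ α * |x| ^ α := by
  have hyα : 0 < y ^ α := Real.rpow_pos_of_pos hy α
  have hT : 0 ≤ Real.exp (h * y) / y ^ α * |x| ^ α := by positivity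
  have hQ : 0 ≤ Real.exp α * h ^ 2 * x ^ 2 := by positivity
  split_ifs with hx
  · rcases le_or_gt (h * x) α with hu | hu
    · have := exp_le_one_add_add_mul_sq hα.le hu
      nlinarith
    · have hx0 : 0 < x := by
        by_contra hc
        nlinarith
      have hlog : α * Real.log (y / x) ≤ h * y - h * x := by
        have h1 := Real.log_le_sub_one_of_pos (div_pos hy hx0)
        have h2 : 0 ≤ y / x - 1 := by
          rw [sub_nonneg, le_div_iff₀ hx0]; linarith
        calc α * Real.log (y / x) ≤ α * (y / x - 1) := mul_le_mul_of_nonneg_left h1 hα.le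
          _ ≤ h * x * (y / x - 1) := mul_le_mul_of_nonneg_right hu.le h2
          _ = h * y - h * x := by field_simp
      have : Real.exp (h * x) ≤ Real.exp (h * y) / y ^ α * |x| ^ α := by
        rw [abs_of_pos hx0, Real.rpow_def_of_pos hy, Real.rpow_def_of_pos hx0, ← Real.exp_sub,
          ← Real.exp_add, Real.exp_le_exp]
        rw [Real.log_div hy.ne' hx0.ne'] at hlog
        linarith
      nlinarith
  · have : 0 < h * x := mul_pos hh (hy.trans (not_le.1 hx))
    simp only [mul_zero, Real.exp_zero]
    linarith

namespace Standardized
variable {Ω : Type*} [MeasurableSpace Ω] {μ : Measure Ω} [IsProbabilityMeasure μ] {X : Ω → ℝ}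
  {α M : ℝ}

theorem mgf_trunc_le (hX : Standardized μ X α M) (hα : 2 ≤ α) {h y : ℝ} (hh : 0 < h)
    (hy : 0 < y) :
    ∫ ω, Real.exp (h * (if X ω ≤ y then X ω else 0)) ∂μ ≤
      Real.exp (Real.exp α * h ^ 2 + Real.exp (h * y) / y ^ α * M) := by
  have hyα : 0 < y ^ α := Real.rpow_pos_of_pos hy α
  have i1 : Integrable (fun ω => 1 + h * X ω) μ :=
    (integrable_const _).add ((hX.integrable (by linarith)).const_mul h)
  have i2 : Integrable (fun ω => Real.exp α * h ^ 2 * X ω ^ 2) μ :=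
    (hX.integrable_pow 2 (by simpa using hα)).const_mul _
  have i12 : Integrable (fun ω => 1 + h * X ω + Real.exp α * h ^ 2 * X ω ^ 2) μ := i1.add i2
  have i3 : Integrable (fun ω => Real.exp (h * y) / y ^ α * |X ω| ^ α) μ :=
    hX.int_alpha.const_mul _
  calc ∫ ω, Real.exp (h * (if X ω ≤ y then X ω else 0)) ∂μ
      ≤ ∫ ω, (1 + h * X ω + Real.exp α * h ^ 2 * X ω ^ 2 +
          Real.exp (h * y) / y ^ α * |X ω| ^ α) ∂μ :=
        integral_mono_of_nonneg (ae_of_all _ fun ω => (Real.exp_pos _).le) (i12.add i3)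
          (ae_of_all _ fun ω => exp_trunc_le hh hy (by linarith))
    _ = 1 + Real.exp α * h ^ 2 + Real.exp (h * y) / y ^ α * ∫ ω, |X ω| ^ α ∂μ := by
        rw [integral_add i12 i3, integral_add i1 i2, integral_add (integrable_const _)
          ((hX.integrable (by linarith)).const_mul h), integral_const_mul, integral_const_mul,
          integral_const_mul, hX.mean, hX.sq]
        simp
    _ ≤ 1 + Real.exp α * h ^ 2 + Real.exp (h * y) / y ^ α * M := by
        gcongr
        exact hX.alpha
    _ ≤ _ := by
        have := Real.add_one_le_exp (Real.exp α * h ^ 2 + Real.exp (h * y) / y ^ α * M)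
        linarith

end Standardized

/-- One-sided Fuk–Nagaev inequality. -/
theorem measureReal_le_sum_le {Ω ι : Type*} [MeasurableSpace Ω] {μ : Measure Ω}
    {α M : ℝ} (hα : 2 ≤ α) (hM : 0 < M) (X : ι → Ω → ℝ) (hmeas : ∀ i, Measurable (X i))
    (hind : ProbabilityTheory.iIndepFun X μ) (I : Finset ι) (hI : I.Nonempty)
    (hX : ∀ i ∈ I, Standardized μ (X i) α M) {x : ℝ} (hx : 0 < x) :
    μ.real {ω | x ≤ ∑ i ∈ I, X i ω} ≤
      4 * 2 ^ α * M * (I.card / x ^ α) +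
        3 * Real.exp (-(x ^ 2 / (4 * Real.exp α * I.card))) := by
  have : IsProbabilityMeasure μ := hind.isProbabilityMeasure
  set N : ℝ := (I.card : ℝ) with hN
  have hN0 : 0 < N := by rw [hN]; exact_mod_cast hI.card_pos
  set y : ℝ := x / 2 with hy
  have hy0 : 0 < y := by positivity
  have hyα : 0 < y ^ α := Real.rpow_pos_of_pos hy0 α
  have hxy : 2 ^ α * M * (N / x ^ α) = N * M / y ^ α := by
    rw [hy, Real.div_rpow hx.le (by norm_num)]
    field_simp
  have hE0 : 0 < Real.exp (-(x ^ 2 / (4 * Real.exp α * N))) := Real.exp_pos _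
  have hgoal : μ.real {ω | x ≤ ∑ i ∈ I, X i ω} ≤ N * M / y ^ α +
      3 * (N * M / y ^ α + Real.exp (-(x ^ 2 / (4 * Real.exp α * N)))) := by
    rcases le_or_gt (y ^ α) (N * M) with hc | hc
    · have h1 : 1 ≤ N * M / y ^ α := by rwa [le_div_iff₀ hyα, one_mul]
      have h2 : μ.real {ω | x ≤ ∑ i ∈ I, X i ω} ≤ 1 := measureReal_le_one
      linarith
    let T : ι → Ω → ℝ := fun i ω => if X i ω ≤ y then X i ω else 0
    have hmt : Measurable fun z : ℝ => if z ≤ y then z else 0 :=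
      Measurable.ite measurableSet_Iic measurable_id measurable_const
    have hTm : ∀ i, Measurable (T i) := fun i => hmt.comp (hmeas i)
    have hTind : ProbabilityTheory.iIndepFun T μ :=
      hind.comp (fun _ z => if z ≤ y then z else 0) fun _ => hmt
    set h₁ : ℝ := x / (2 * N * Real.exp α) with hh₁
    set h₂ : ℝ := Real.log (y ^ α / (N * M)) / y with hh₂
    have hh₁0 : 0 < h₁ := by positivity
    have hh₂0 : 0 < h₂ := by
      refine div_pos (Real.log_pos ?_) hy0
      rwa [one_lt_div (by positivity)]
    set h : ℝ := min h₁ h₂ with hh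
    have hh0 : 0 < h := lt_min hh₁0 hh₂0
    have hmgf : ∫ ω, Real.exp (h * ∑ i ∈ I, T i ω) ∂μ ≤
        Real.exp (N * (Real.exp α * h ^ 2 + Real.exp (h * y) / y ^ α * M)) := by
      have h1 := hTind.mgf_sum (t := h) hTm I
      simp only [ProbabilityTheory.mgf, Finset.sum_apply] at h1
      rw [h1, hN, ← nsmul_eq_mul, Real.exp_nsmul, ← Finset.prod_const]
      exact Finset.prod_le_prod (fun i _ => integral_nonneg fun ω => (Real.exp_pos _).le)
        fun i hi => (hX i hi).mgf_trunc_le hα hh0 hy0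
    have hTint : Integrable (fun ω => Real.exp (h * ∑ i ∈ I, T i ω)) μ := by
      refine Integrable.mono' (integrable_const (Real.exp (h * (N * y)))) ?_
        (ae_of_all _ fun ω => ?_)
      · exact (Real.measurable_exp.comp ((Finset.measurable_sum I fun i _ => hTm i).const_mul
          h)).aestronglyMeasurable
      · rw [Real.norm_eq_abs, abs_of_pos (Real.exp_pos _), Real.exp_le_exp, hN, ← nsmul_eq_mul]
        refine mul_le_mul_of_nonneg_left (Finset.sum_le_card_nsmul _ _ _ fun i _ => ?_) hh0.le
        simp only [T]
        split_ifs with hc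
        · exact hc
        · exact hy0.le
    have hch : μ.real {ω | x ≤ ∑ i ∈ I, T i ω} ≤
        3 * (N * M / y ^ α + Real.exp (-(x ^ 2 / (4 * Real.exp α * N)))) := by
      have h1 := ProbabilityTheory.measure_ge_le_exp_mul_mgf (μ := μ)
        (X := fun ω => ∑ i ∈ I, T i ω) x hh0.le hTint
      have h3 : N * (Real.exp α * h ^ 2) ≤ h * x / 2 := by
        have : h * (2 * N * Real.exp α) ≤ x := by
          rw [← le_div_iff₀ (by positivity)]; exact min_le_left _ _
        nlinarith
      have h4 : N * (Real.exp (h * y) / y ^ α * M) ≤ 1 := by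
        have h5 : Real.exp (h * y) ≤ y ^ α / (N * M) := by
          have h6 : h * y ≤ Real.log (y ^ α / (N * M)) := by
            rw [← le_div_iff₀ hy0]; exact min_le_right _ _
          calc Real.exp (h * y) ≤ Real.exp (Real.log (y ^ α / (N * M))) := Real.exp_le_exp.2 h6
            _ = _ := Real.exp_log (by positivity)
        calc N * (Real.exp (h * y) / y ^ α * M) ≤ N * (y ^ α / (N * M) / y ^ α * M) := by gcongr
          _ = 1 := by field_simp
      have h7 : Real.exp (-(h * x / 2)) ≤
          N * M / y ^ α + Real.exp (-(x ^ 2 / (4 * Real.exp α * N))) := by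
        rcases min_choice h₁ h₂ with hm | hm
        · have : h * x / 2 = x ^ 2 / (4 * Real.exp α * N) := by
            have hm' : h = x / (2 * N * Real.exp α) := hm
            have hE := Real.exp_pos α
            rw [hm']
            generalize Real.exp α = e at hE ⊢
            field_simp
            norm_num
          rw [this]
          have : 0 < N * M / y ^ α := div_pos (mul_pos hN0 hM) hyα
          linarith
        · have h8 : h * x / 2 = Real.log (y ^ α / (N * M)) := by
            have hm' : h = h₂ := hm
            rw [hm', hh₂, mul_div_assoc, ← hy, div_mul_cancel₀ _ hy0.ne']
          rw [h8, Real.exp_neg, Real.exp_log (div_pos hyα (mul_pos hN0 hM)), inv_div]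
          linarith
      calc μ.real {ω | x ≤ ∑ i ∈ I, T i ω}
          ≤ Real.exp (-h * x) * Real.exp (N * (Real.exp α * h ^ 2 +
              Real.exp (h * y) / y ^ α * M)) :=
            h1.trans (mul_le_mul_of_nonneg_left hmgf (Real.exp_pos _).le)
        _ ≤ Real.exp (1 + -(h * x / 2)) := by
            rw [← Real.exp_add, Real.exp_le_exp]
            linarith
        _ = Real.exp 1 * Real.exp (-(h * x / 2)) := Real.exp_add _ _
        _ ≤ 3 * (N * M / y ^ α + Real.exp (-(x ^ 2 / (4 * Real.exp α * N)))) := by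
            have := Real.exp_one_lt_d9
            exact mul_le_mul (by linarith) h7 (Real.exp_pos _).le (by norm_num)
    calc μ.real {ω | x ≤ ∑ i ∈ I, X i ω}
        ≤ μ.real ((⋃ i ∈ I, {ω | y < X i ω}) ∪ {ω | x ≤ ∑ i ∈ I, T i ω}) := by
          refine measureReal_mono ?_ (measure_ne_top _ _)
          intro ω hω
          by_cases hex : ∃ i ∈ I, y < X i ω
          · left
            simpa using hex
          · right
            push Not at hex
            refine (show x ≤ _ from hω).trans (Finset.sum_le_sum fun i hi => ?_)
            simp [T, hex i hi]
      _ ≤ μ.real (⋃ i ∈ I, {ω | y < X i ω}) + μ.real {ω | x ≤ ∑ i ∈ I, T i ω} :=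
          measureReal_union_le _ _
      _ ≤ ∑ i ∈ I, μ.real {ω | y < X i ω} + μ.real {ω | x ≤ ∑ i ∈ I, T i ω} := by
          gcongr
          exact measureReal_biUnion_finset_le _ _
      _ ≤ ∑ i ∈ I, M / y ^ α +
          3 * (N * M / y ^ α + Real.exp (-(x ^ 2 / (4 * Real.exp α * N)))) :=
          add_le_add (Finset.sum_le_sum fun i hi => (hX i hi).measureReal_lt_le (by linarith) hy0)
            hch
      _ = _ := by
          rw [Finset.sum_const, nsmul_eq_mul, ← hN]
          ring
  calc _ ≤ _ := hgoal
    _ = _ := by rw [← hxy]; ring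

/-- Fuk–Nagaev inequality. -/
theorem measureReal_le_abs_sum_le {Ω ι : Type*} [MeasurableSpace Ω] {μ : Measure Ω}
    {α M : ℝ} (hα : 2 ≤ α) (hM : 0 < M) (X : ι → Ω → ℝ) (hmeas : ∀ i, Measurable (X i))
    (hind : ProbabilityTheory.iIndepFun X μ) (I : Finset ι) (hI : I.Nonempty)
    (hX : ∀ i ∈ I, Standardized μ (X i) α M) {x : ℝ} (hx : 0 < x) :
    μ.real {ω | x ≤ |∑ i ∈ I, X i ω|} ≤
      8 * 2 ^ α * M * (I.card / x ^ α) +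
        6 * Real.exp (-(x ^ 2 / (4 * Real.exp α * I.card))) := by
  have : IsProbabilityMeasure μ := hind.isProbabilityMeasure
  have h1 := measureReal_le_sum_le hα hM X hmeas hind I hI hX hx
  have h2 := measureReal_le_sum_le hα hM (fun i ω => -X i ω) (fun i => (hmeas i).neg)
    (hind.comp (fun _ z => -z) fun _ => measurable_neg) I hI (fun i hi => (hX i hi).neg) hx
  calc _ ≤ μ.real ({ω | x ≤ ∑ i ∈ I, X i ω} ∪ {ω | x ≤ ∑ i ∈ I, -X i ω}) := by
        refine measureReal_mono ?_ (measure_ne_top _ _)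
        intro ω hω
        rcases le_abs.1 (show x ≤ |∑ i ∈ I, X i ω| from hω) with h | h
        · left; exact h
        · right
          rw [← Finset.sum_neg_distrib] at h
          exact h
    _ ≤ _ := measureReal_union_le _ _
    _ ≤ _ := by linarith

/-- Moments of a sum of `N` independent standardized random variables. -/
theorem Standardized.sum_moments {Ω ι : Type*} [MeasurableSpace Ω] {μ : Measure Ω}
    {α M : ℝ} (hα : 4 ≤ α) (X : ι → Ω → ℝ) (hmeas : ∀ i, Measurable (X i))
    (hind : ProbabilityTheory.iIndepFun X μ) (I : Finset ι)
    (hX : ∀ i ∈ I, Standardized μ (X i) α M) :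
    (∀ k ≤ 4, Integrable (fun ω => (∑ i ∈ I, X i ω) ^ k) μ) ∧
      ∫ ω, (∑ i ∈ I, X i ω) ∂μ = 0 ∧ ∫ ω, (∑ i ∈ I, X i ω) ^ 2 ∂μ = I.card ∧
      ∫ ω, (∑ i ∈ I, X i ω) ^ 4 ∂μ ≤ 3 * (I.card : ℝ) ^ 2 + (1 + M) * I.card := by
  have : IsProbabilityMeasure μ := hind.isProbabilityMeasure
  induction I using Finset.induction_on with
  | empty =>
    refine ⟨fun k _ => ?_, ?_, ?_, ?_⟩
    · simp
    · simp
    · simp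
    · simp
  | insert a I ha ih =>
    obtain ⟨hk, h1, h2, h4⟩ := ih fun i hi => hX i (Finset.mem_insert_of_mem hi)
    have hXa := hX a (Finset.mem_insert_self a I)
    have hXk : ∀ k ≤ 4, Integrable (fun ω => X a ω ^ k) μ := fun k hk4 =>
      hXa.integrable_pow k (le_trans (by exact_mod_cast hk4) hα)
    have hind' : ProbabilityTheory.IndepFun (fun ω => ∑ i ∈ I, X i ω) (X a) μ := by
      have := hind.indepFun_finsetSum_of_notMem hmeas ha
      convert this using 1
      ext ω
      simp
    have hind2 : ∀ k l : ℕ, ProbabilityTheory.IndepFun (fun ω => (∑ i ∈ I, X i ω) ^ k)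
        (fun ω => X a ω ^ l) μ := fun k l =>
      hind'.comp (φ := fun z : ℝ => z ^ k) (ψ := fun z : ℝ => z ^ l) (by fun_prop) (by fun_prop)
    have hpi : ∀ k ≤ 4, ∀ l ≤ 4, Integrable (fun ω => (∑ i ∈ I, X i ω) ^ k * X a ω ^ l) μ :=
      fun k hk4 l hl4 => (hind2 k l).integrable_mul (hk k hk4) (hXk l hl4)
    have hpe : ∀ k l : ℕ, k ≤ 4 → l ≤ 4 → ∫ ω, (∑ i ∈ I, X i ω) ^ k * X a ω ^ l ∂μ =
        (∫ ω, (∑ i ∈ I, X i ω) ^ k ∂μ) * ∫ ω, X a ω ^ l ∂μ := fun k l hk4 hl4 =>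
      (hind2 k l).integral_mul_eq_mul_integral (hk k hk4).aestronglyMeasurable
        (hXk l hl4).aestronglyMeasurable
    simp only [Finset.sum_insert ha, Finset.card_insert_of_notMem ha]
    have hbin : ∀ k ω, (X a ω + ∑ i ∈ I, X i ω) ^ k = ∑ l ∈ Finset.range (k + 1),
        (k.choose l : ℝ) * ((∑ i ∈ I, X i ω) ^ l * X a ω ^ (k - l)) := by
      intro k ω
      rw [add_comm, add_pow]
      exact Finset.sum_congr rfl fun l _ => by ring
    have h_int : ∀ k ≤ 4, ∀ l ∈ Finset.range (k + 1), Integrable (fun ω => (k.choose l : ℝ) *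
        ((∑ i ∈ I, X i ω) ^ l * X a ω ^ (k - l))) μ := by
      intro k hk4 l hl
      have := Finset.mem_range.1 hl
      exact (hpi l (by omega) (k - l) (by omega)).const_mul _
    have h_integral : ∀ k ≤ 4, ∫ ω, (X a ω + ∑ i ∈ I, X i ω) ^ k ∂μ = ∑ l ∈ Finset.range (k + 1),
        (k.choose l : ℝ) * ((∫ ω, (∑ i ∈ I, X i ω) ^ l ∂μ) * ∫ ω, X a ω ^ (k - l) ∂μ) := by
      intro k hk4
      simp only [hbin k]
      rw [integral_finsetSum _ (h_int k hk4)]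
      refine Finset.sum_congr rfl fun l hl => ?_
      have := Finset.mem_range.1 hl
      rw [integral_const_mul, hpe l (k - l) (by omega) (by omega)]
    have e1 : ∫ ω, X a ω ^ 1 ∂μ = 0 := by simpa using hXa.mean
    have s1 : ∫ ω, (∑ i ∈ I, X i ω) ^ 1 ∂μ = 0 := by simpa using h1
    refine ⟨fun k hk4 => ?_, ?_, ?_, ?_⟩
    · simp only [hbin k]
      exact integrable_finsetSum _ (h_int k hk4)
    · have := h_integral 1 (by norm_num)
      simp only [Finset.sum_range_succ, Finset.sum_range_zero, s1, e1] at this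
      simpa [s1, e1, h1, hXa.mean] using this
    · rw [h_integral 2 (by norm_num)]
      simp [Finset.sum_range_succ, h1, h2, hXa.mean, hXa.sq]
      ring
    · rw [h_integral 4 le_rfl]
      have h5 := hXa.integral_pow_four_le hα
      simp [Finset.sum_range_succ, h1, h2, hXa.mean, hXa.sq]
      norm_num [Nat.choose]
      nlinarith

/-- The squared mean of `m` independent standardized random variables is an unbiased estimate of
`1 / m`, with variance of order `1 / m ^ 2`. -/
theorem Standardized.sq_mean_moments {Ω ι : Type*} [MeasurableSpace Ω] {μ : Measure Ω}
    {α M : ℝ} (hα : 4 ≤ α) (hM : 0 < M) (X : ι → Ω → ℝ) (hmeas : ∀ i, Measurable (X i))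
    (hind : ProbabilityTheory.iIndepFun X μ) (I : Finset ι) (hI : I.Nonempty)
    (hX : ∀ i ∈ I, Standardized μ (X i) α M) :
    Integrable (fun ω => ((∑ i ∈ I, X i ω) / I.card) ^ 2) μ ∧
      Integrable (fun ω => (((∑ i ∈ I, X i ω) / I.card) ^ 2 - 1 / I.card) ^ 2) μ ∧
      ∫ ω, ((∑ i ∈ I, X i ω) / I.card) ^ 2 ∂μ = 1 / I.card ∧
      ∫ ω, (((∑ i ∈ I, X i ω) / I.card) ^ 2 - 1 / I.card) ^ 2 ∂μ ≤
        (4 + M) * (1 / I.card) ^ 2 := by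
  have : IsProbabilityMeasure μ := hind.isProbabilityMeasure
  obtain ⟨hk, -, h2, h4⟩ := Standardized.sum_moments hα X hmeas hind I hX
  set N : ℝ := (I.card : ℝ) with hN
  have hN1 : 1 ≤ N := by rw [hN]; exact_mod_cast hI.card_pos
  have hN0 : 0 < N := by linarith
  have i2 : Integrable (fun ω => (1 / N ^ 2) * (∑ i ∈ I, X i ω) ^ 2) μ :=
    (hk 2 (by norm_num)).const_mul _
  have i4 : Integrable (fun ω => (1 / N ^ 4) * (∑ i ∈ I, X i ω) ^ 4) μ :=
    (hk 4 le_rfl).const_mul _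
  have i2' : Integrable (fun ω => (2 / N ^ 3) * (∑ i ∈ I, X i ω) ^ 2) μ :=
    (hk 2 (by norm_num)).const_mul _
  have e2 : ∀ ω, ((∑ i ∈ I, X i ω) / N) ^ 2 = (1 / N ^ 2) * (∑ i ∈ I, X i ω) ^ 2 := by
    intro ω; ring
  have e4 : ∀ ω, (((∑ i ∈ I, X i ω) / N) ^ 2 - 1 / N) ^ 2 = (1 / N ^ 4) * (∑ i ∈ I, X i ω) ^ 4 -
      (2 / N ^ 3) * (∑ i ∈ I, X i ω) ^ 2 + 1 / N ^ 2 := by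
    intro ω; ring
  have i42 : Integrable (fun ω => (1 / N ^ 4) * (∑ i ∈ I, X i ω) ^ 4 -
      (2 / N ^ 3) * (∑ i ∈ I, X i ω) ^ 2) μ := i4.sub i2'
  refine ⟨?_, ?_, ?_, ?_⟩
  · simpa only [e2] using i2
  · simp only [e4]
    exact i42.add (integrable_const _)
  · simp only [e2]
    rw [integral_const_mul, h2]
    field_simp
  · simp only [e4]
    rw [integral_add i42 (integrable_const _), integral_sub i4 i2', integral_const_mul,
      integral_const_mul, h2]
    simp only [integral_const, probReal_univ, smul_eq_mul, one_mul]
    have h5 : 1 / N ^ 4 * ∫ ω, (∑ i ∈ I, X i ω) ^ 4 ∂μ ≤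
        1 / N ^ 4 * (3 * N ^ 2 + (1 + M) * N) := by gcongr
    have h6 : 1 / N ^ 4 * (3 * N ^ 2 + (1 + M) * N) ≤ 1 / N ^ 4 * ((4 + M) * N ^ 2) := by
      gcongr
      nlinarith [mul_nonneg (by linarith : (0:ℝ) ≤ 1 + M)
        (mul_nonneg hN0.le (sub_nonneg.2 hN1))]
    have h7 : 1 / N ^ 4 * ((4 + M) * N ^ 2) = (4 + M) * (1 / N) ^ 2 := by field_simp
    have h8 : 2 / N ^ 3 * N = 2 / N ^ 2 := by field_simp
    have h9 : 0 < 1 / N ^ 2 := by positivity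
    have h10 : 2 / N ^ 2 = 2 * (1 / N ^ 2) := by ring
    linarith

theorem Standardized.sub_div_sqrt_two {Ω : Type*} [MeasurableSpace Ω] {μ : Measure Ω}
    [IsProbabilityMeasure μ] {X Y : Ω → ℝ} {α M : ℝ} (hα : 2 ≤ α)
    (hX : Standardized μ X α M) (hY : Standardized μ Y α M)
    (h : ProbabilityTheory.IndepFun X Y μ) :
    Standardized μ (fun ω => (X ω - Y ω) / √2) α (2 ^ α * (M + M)) := by
  have hb : ∀ x y : ℝ, |(x - y) / √2| ^ α ≤ 2 ^ α * (|x| ^ α + |y| ^ α) := by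
    intro x y
    have hs : (1 : ℝ) ≤ √2 := Real.one_le_sqrt.2 (by norm_num)
    have hx : 0 ≤ |x| ^ α := by positivity
    have hy : 0 ≤ |y| ^ α := by positivity
    have h1 : |(x - y) / √2| ≤ 2 * max |x| |y| := by
      rw [abs_div, abs_of_nonneg (Real.sqrt_nonneg 2)]
      refine (div_le_self (abs_nonneg _) hs).trans ((abs_sub x y).trans ?_)
      linarith [le_max_left |x| |y|, le_max_right |x| |y|]
    calc |(x - y) / √2| ^ α ≤ (2 * max |x| |y|) ^ α :=
          Real.rpow_le_rpow (abs_nonneg _) h1 (by linarith)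
      _ = 2 ^ α * (max |x| |y|) ^ α :=
          Real.mul_rpow (by norm_num) (le_max_of_le_left (abs_nonneg _))
      _ ≤ _ := by
          refine mul_le_mul_of_nonneg_left ?_ (by positivity)
          rcases max_choice |x| |y| with h | h <;> rw [h] <;> linarith
  have h_int : Integrable (fun ω => 2 ^ α * (|X ω| ^ α + |Y ω| ^ α)) μ :=
    (hX.int_alpha.add hY.int_alpha).const_mul _
  have hm : Measurable fun ω => (X ω - Y ω) / √2 := (hX.meas.sub hY.meas).div_const _
  have hi : Integrable (fun ω => |(X ω - Y ω) / √2| ^ α) μ := by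
    refine h_int.mono' (hm.abs.pow_const α).aestronglyMeasurable (ae_of_all _ fun ω => ?_)
    rw [Real.norm_of_nonneg (by positivity)]
    exact hb _ _
  have iX := hX.integrable (by linarith)
  have iY := hY.integrable (by linarith)
  have iX2 := hX.integrable_pow 2 (by simpa using hα)
  have iY2 := hY.integrable_pow 2 (by simpa using hα)
  have iXY : Integrable (fun ω => X ω * Y ω) μ := h.integrable_mul iX iY
  refine ⟨hm, hi, ?_, ?_, ?_⟩
  · rw [integral_div, integral_sub iX iY, hX.mean, hY.mean]; simp
  · have e : (fun ω => ((X ω - Y ω) / √2) ^ 2) =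
        fun ω => (1 / 2) * (X ω ^ 2 + Y ω ^ 2 - 2 * (X ω * Y ω)) := by
      funext ω
      rw [div_pow, Real.sq_sqrt (by norm_num)]; ring
    have hxy : ∫ ω, X ω * Y ω ∂μ = 0 := by
      have := h.integral_mul_eq_mul_integral iX.aestronglyMeasurable iY.aestronglyMeasurable
      simpa [hX.mean] using this
    have i2 : Integrable (fun ω => X ω ^ 2 + Y ω ^ 2) μ := iX2.add iY2
    rw [e, integral_const_mul, integral_sub i2 (iXY.const_mul 2), integral_add iX2 iY2,
      integral_const_mul, hX.sq, hY.sq, hxy]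
    norm_num
  · refine (integral_mono hi h_int fun ω => hb _ _).trans ?_
    rw [integral_const_mul, integral_add hX.int_alpha hY.int_alpha]
    exact mul_le_mul_of_nonneg_left (add_le_add hX.alpha hY.alpha) (by positivity)

theorem Standardized.of_memP {Ω : Type*} [MeasurableSpace Ω] {μ : Measure Ω}
    {X : Ω → ℝ} {α K : ℝ} (hK : 0 < K) {ν : Measure ℝ} (hν : memP α K ν)
    (hm : Measurable X) (hX : μ.map X = ν) :
    Standardized μ X α (K ^ α) := by
  obtain ⟨-, -, h0, h2, h4⟩ := hν
  subst hX
  have hKα : 0 < K ^ α := Real.rpow_pos_of_pos hK α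
  rw [lintegral_map (by fun_prop) hm] at h2 h4
  have e : (fun ω => |X ω| ^ α) = fun ω => K ^ α * |X ω / K| ^ α := by
    funext ω
    rw [abs_div, abs_of_pos hK, Real.div_rpow (abs_nonneg _) hK.le]
    field_simp
  have mα : Measurable fun ω => |X ω / K| ^ α := by fun_prop
  have hi : Integrable (fun ω => |X ω / K| ^ α) μ := by
    refine ⟨mα.aestronglyMeasurable, ?_⟩
    rw [hasFiniteIntegral_iff_ofReal (ae_of_all _ fun ω => by positivity)]
    exact h4.trans_lt ENNReal.one_lt_top
  refine ⟨hm, ?_, ?_, ?_, ?_⟩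
  · rw [e]; exact hi.const_mul _
  · rwa [integral_map hm.aemeasurable (by fun_prop)] at h0
  · rw [integral_eq_lintegral_of_nonneg_ae (ae_of_all _ fun ω => by positivity) (by fun_prop), h2]
    simp
  · rw [e, integral_const_mul, integral_eq_lintegral_of_nonneg_ae
      (ae_of_all _ fun ω => by positivity) mα.aestronglyMeasurable]
    refine mul_le_of_le_one_right hKα.le ?_
    exact ENNReal.toReal_le_of_le_ofReal zero_le_one (by simpa using h4)

theorem IsEntrywiseProduct.map_eq {p n : ℕ} {P : Measure (Fin n → Fin p → ℝ)}
    {ν : Fin n → Fin p → Measure ℝ} (h : IsEntrywiseProduct p n P ν)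
    (hν : ∀ t j, IsProbabilityMeasure (ν t j)) (t : Fin n) (j : Fin p) :
    P.map (fun E => E t j) = ν t j := by
  ext A hA
  rw [Measure.map_apply (by fun_prop) hA]
  have := h.2 (fun t' j' => if t' = t ∧ j' = j then A else Set.univ) (by
    intro t' j'; split_ifs <;> measurability)
  have e : {x : Fin n → Fin p → ℝ | ∀ t' j', x t' j' ∈
      (if t' = t ∧ j' = j then A else Set.univ)} = (fun E => E t j) ⁻¹' A := by
    ext x
    simp only [Set.mem_ofPred_eq, Set.mem_preimage]
    refine ⟨fun hx => by simpa using hx t j, fun hx t' j' => ?_⟩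
    split_ifs with hc
    · rw [hc.1, hc.2]; exact hx
    · trivial
  rw [e] at this
  rw [this, Finset.prod_eq_single t, Finset.prod_eq_single j]
  · simp
  · intro j' _ hj; simp [hj]
  · simp
  · intro t' _ ht; simp [ht]
  · simp

theorem IsEntrywiseProduct.iIndepFun {p n : ℕ} {P : Measure (Fin n → Fin p → ℝ)}
    {ν : Fin n → Fin p → Measure ℝ} (h : IsEntrywiseProduct p n P ν)
    (hν : ∀ t j, IsProbabilityMeasure (ν t j)) :
    ProbabilityTheory.iIndepFun (fun (q : Fin n × Fin p) (E : Fin n → Fin p → ℝ) => E q.1 q.2)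
      P := by
  rw [ProbabilityTheory.iIndepFun_iff_measure_inter_preimage_eq_mul]
  intro S A hA
  have := h.2 (fun t j => if (t, j) ∈ S then A (t, j) else Set.univ) (by
    intro t j
    split_ifs with hc
    · exact hA _ hc
    · exact MeasurableSet.univ)
  have e : {x : Fin n → Fin p → ℝ | ∀ t j, x t j ∈
      (if (t, j) ∈ S then A (t, j) else Set.univ)} =
      ⋂ q ∈ S, (fun E : Fin n → Fin p → ℝ => E q.1 q.2) ⁻¹' A q := by
    ext x
    simp only [Set.mem_ofPred_eq, Set.mem_iInter, Set.mem_preimage]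
    refine ⟨fun hx q hq => by simpa [hq] using hx q.1 q.2, fun hx t j => ?_⟩
    split_ifs with hc
    · exact hx (t, j) hc
    · trivial
  rw [e] at this
  rw [this, ← Fintype.prod_prod_type' (f := fun t j =>
    ν t j (if (t, j) ∈ S then A (t, j) else Set.univ)), ← Finset.prod_subset (Finset.subset_univ S)]
  · refine Finset.prod_congr rfl fun q hq => ?_
    rw [← h.map_eq hν, Measure.map_apply (by fun_prop) (by simpa [hq] using hA q hq)]
    simp [hq]
  · intro q _ hq
    simp [hq]

/-- The differences `Z_i` for `i < ⌊n/2⌋`, extended by zero. -/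
noncomputable def halfDiff (p n : ℕ) (q : ℕ × Fin p) (E : Fin n → Fin p → ℝ) : ℝ :=
  if q.1 < n / 2 then Zb p n E q.1 q.2 else 0

theorem measurable_col (p n i : ℕ) (j : Fin p) :
    Measurable fun E : Fin n → Fin p → ℝ => col p n E i j := by
  unfold col
  split_ifs
  · fun_prop
  · exact measurable_const

theorem measurable_Zb (p n i : ℕ) (j : Fin p) :
    Measurable fun E : Fin n → Fin p → ℝ => Zb p n E i j :=
  ((measurable_col p n i j).sub (measurable_col p n _ j)).div_const _

theorem measurable_halfDiff (p n : ℕ) (q : ℕ × Fin p) : Measurable (halfDiff p n q) := by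
  unfold halfDiff
  split_ifs
  · exact measurable_Zb p n _ _
  · exact measurable_const

theorem iIndepFun_halfDiff {p n : ℕ} {P : Measure (Fin n → Fin p → ℝ)} {α K : ℝ}
    (hP : P ∈ Pclass p n α K) : ProbabilityTheory.iIndepFun (halfDiff p n) P := by
  obtain ⟨ν, hν, h⟩ := hP
  have hind := h.iIndepFun fun t j => (hν t j).1
  let S : ℕ × Fin p → Finset (Fin n × Fin p) := fun q => Finset.univ.filter fun r =>
    (min (r.1 : ℕ) (n - 1 - r.1), r.2) = q
  refine iIndepFun_of_color (fun (q : Fin n × Fin p) (E : Fin n → Fin p → ℝ) => E q.1 q.2)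
    (fun q => by fun_prop) hind (fun r => (min (r.1 : ℕ) (n - 1 - r.1), r.2)) S
    (fun k i hi => (Finset.mem_filter.1 hi).2)
    (fun q x => halfDiff p n q fun t j => x (t, j))
    (fun q => (measurable_halfDiff p n q).comp (by fun_prop)) ?_
  intro q x y hxy
  unfold halfDiff Zb col
  by_cases hq : q.1 < n / 2
  · have h1 : q.1 < n := by omega
    have h2 : n - 1 - q.1 < n := by omega
    simp only [hq, h1, h2, if_true, dif_pos]
    rw [hxy (⟨q.1, h1⟩, q.2), hxy (⟨n - 1 - q.1, h2⟩, q.2)]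
    · refine Finset.mem_filter.2 ⟨Finset.mem_univ _, Prod.ext ?_ rfl⟩
      simp only; omega
    · refine Finset.mem_filter.2 ⟨Finset.mem_univ _, Prod.ext ?_ rfl⟩
      simp only; omega
  · simp [hq]

theorem standardized_halfDiff {p n : ℕ} {P : Measure (Fin n → Fin p → ℝ)} {α K : ℝ}
    (hα : 2 ≤ α) (hK : 0 < K) (hP : P ∈ Pclass p n α K) {i : ℕ} (hi : i < n / 2) (j : Fin p) :
    Standardized P (halfDiff p n (i, j)) α (2 ^ α * (K ^ α + K ^ α)) := by
  obtain ⟨ν, hν, h⟩ := hP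
  have := h.1
  have hind := h.iIndepFun fun t j => (hν t j).1
  have h1 : i < n := by omega
  have h2 : n - 1 - i < n := by omega
  have hs : ∀ t, Standardized P (fun E => E t j) α (K ^ α) := fun t =>
    .of_memP hK (hν t j) (by fun_prop) (h.map_eq (fun t j => (hν t j).1) t j)
  have hne : ((⟨i, h1⟩, j) : Fin n × Fin p) ≠ (⟨n - 1 - i, h2⟩, j) := by
    simp only [ne_eq, Prod.mk.injEq, Fin.mk.injEq, and_true]; omega
  have key := (hs ⟨i, h1⟩).sub_div_sqrt_two hα (hs ⟨n - 1 - i, h2⟩) (hind.indepFun hne)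
  have e : halfDiff p n (i, j) = fun E => (E ⟨i, h1⟩ j - E ⟨n - 1 - i, h2⟩ j) / √2 := by
    funext E
    simp [halfDiff, hi, Zb, col, h1, h2]
  rw [e]; exact key

/-- The normalized sum of the first `N` odd-indexed (0-based) rows. -/
noncomputable def oddSum {p : ℕ} (N : ℕ) (x : ℕ × Fin p → ℝ) (j : Fin p) : ℝ :=
  (∑ i ∈ Finset.range N, x (2 * i + 1, j)) / √N

/-- The mean of the `g`-th block of `m` consecutive even-indexed (0-based) rows. -/
noncomputable def evenMean {p : ℕ} (m g : ℕ) (x : ℕ × Fin p → ℝ) (j : Fin p) : ℝ :=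
  (∑ i ∈ Finset.range m, x (2 * (g * m + i), j)) / m

theorem measurable_oddSum {p : ℕ} (N : ℕ) (j : Fin p) :
    Measurable fun x : ℕ × Fin p → ℝ => oddSum N x j := by
  unfold oddSum; fun_prop

theorem measurable_evenMean {p : ℕ} (m g : ℕ) (j : Fin p) :
    Measurable fun x : ℕ × Fin p → ℝ => evenMean m g x j := by
  unfold evenMean; fun_prop

theorem rpow_half_bound {a α : ℝ} {N : ℕ} (hα : 4 ≤ α) (ha : 0 < a) (hN : 1 ≤ N) :
    (N : ℝ) / (a * √N) ^ α ≤ 1 / (N * a ^ α) := by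
  have hN1 : (1 : ℝ) ≤ N := by exact_mod_cast hN
  have hs : (1 : ℝ) ≤ √N := Real.one_le_sqrt.2 hN1
  have haα : 0 < a ^ α := Real.rpow_pos_of_pos ha α
  have h4 : (N : ℝ) ^ 2 ≤ √N ^ α := by
    have h := Real.rpow_le_rpow_of_exponent_le hs hα
    have e : √(N : ℝ) ^ (4 : ℝ) = (N : ℝ) ^ 2 := by
      have : (4 : ℝ) = ((4 : ℕ) : ℝ) := by norm_num
      rw [this, Real.rpow_natCast, show 4 = 2 * 2 from rfl, pow_mul, Real.sq_sqrt (by positivity)]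
    rwa [e] at h
  rw [Real.mul_rpow ha.le (Real.sqrt_nonneg _), div_le_div_iff₀ (by positivity) (by positivity)]
  nlinarith

section
variable {Ω : Type*} [MeasurableSpace Ω] {μ : Measure Ω} {p : ℕ} {W : ℕ × Fin p → Ω → ℝ}
  {h : ℕ} {α M : ℝ}

theorem measureReal_le_oddSum_le (hα : 4 ≤ α) (hM : 0 < M) (hm : ∀ q, Measurable (W q))
    (hi : ProbabilityTheory.iIndepFun W μ)
    (hs : ∀ i < h, ∀ j, Standardized μ (W (i, j)) α M)
    {N : ℕ} (hN : 1 ≤ N) (hNh : 2 * N ≤ h) {a : ℝ} (ha : 0 < a) (j : Fin p) :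
    μ.real {ω | a ≤ |oddSum N (fun q => W q ω) j|} ≤
      8 * 2 ^ α * M * (1 / (N * a ^ α)) + 6 * Real.exp (-(a ^ 2 / (4 * Real.exp α))) := by
  have hinj : Function.Injective fun i : ℕ => (2 * i + 1, j) := by
    intro i i' hii; simp only [Prod.mk.injEq, and_true] at hii; omega
  have hN0 : (0 : ℝ) < N := by exact_mod_cast hN
  have key := measureReal_le_abs_sum_le (by linarith : (2 : ℝ) ≤ α) hM
    (fun i => W (2 * i + 1, j)) (fun i => hm _) (hi.precomp hinj) (Finset.range N)
    (Finset.nonempty_range_iff.2 (by omega))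
    (fun i hi' => hs _ (by have := Finset.mem_range.1 hi'; omega) j)
    (x := a * √N) (by positivity)
  have e : {ω | a ≤ |oddSum N (fun q => W q ω) j|} =
      {ω | a * √N ≤ |∑ i ∈ Finset.range N, W (2 * i + 1, j) ω|} := by
    ext ω
    have : 0 < √(N : ℝ) := Real.sqrt_pos.2 hN0
    simp only [oddSum, Set.mem_ofPred_eq, abs_div, abs_of_pos this, le_div_iff₀ this]
  rw [e]
  refine key.trans ?_
  rw [Finset.card_range]
  refine add_le_add (mul_le_mul_of_nonneg_left (rpow_half_bound hα ha hN) (by positivity)) ?_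
  rw [mul_pow, Real.sq_sqrt hN0.le, mul_div_mul_right _ _ hN0.ne']

theorem integral_oddSum_sq (hα : 4 ≤ α) (hm : ∀ q, Measurable (W q))
    (hi : ProbabilityTheory.iIndepFun W μ)
    (hs : ∀ i < h, ∀ j, Standardized μ (W (i, j)) α M)
    {N : ℕ} (hN : 1 ≤ N) (hNh : 2 * N ≤ h) (j : Fin p) :
    Integrable (fun ω => oddSum N (fun q => W q ω) j ^ 2) μ ∧
      ∫ ω, oddSum N (fun q => W q ω) j ^ 2 ∂μ = 1 := by
  have hinj : Function.Injective fun i : ℕ => (2 * i + 1, j) := by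
    intro i i' hii; simp only [Prod.mk.injEq, and_true] at hii; omega
  have hN0 : (0 : ℝ) < N := by exact_mod_cast hN
  obtain ⟨h1, -, h2, -⟩ := Standardized.sum_moments hα
    (fun i => W (2 * i + 1, j)) (fun i => hm _) (hi.precomp hinj) (Finset.range N)
    (fun i hi' => hs _ (by have := Finset.mem_range.1 hi'; omega) j)
  simp only [oddSum, div_pow, Real.sq_sqrt hN0.le]
  refine ⟨(h1 2 (by norm_num)).div_const _, ?_⟩
  rw [integral_div, h2, Finset.card_range, div_self hN0.ne']

theorem evenMean_moments (hα : 4 ≤ α) (hM : 0 < M) (hm : ∀ q, Measurable (W q))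
    (hi : ProbabilityTheory.iIndepFun W μ)
    (hs : ∀ i < h, ∀ j, Standardized μ (W (i, j)) α M)
    {m g : ℕ} (hm1 : 1 ≤ m) (hgh : 2 * ((g + 1) * m) ≤ h) (j : Fin p) :
    Integrable (fun ω => evenMean m g (fun q => W q ω) j ^ 2) μ ∧
    Integrable (fun ω => (evenMean m g (fun q => W q ω) j ^ 2 - 1 / m) ^ 2) μ ∧
    ∫ ω, evenMean m g (fun q => W q ω) j ^ 2 ∂μ = 1 / m ∧
    ∫ ω, (evenMean m g (fun q => W q ω) j ^ 2 - 1 / m) ^ 2 ∂μ ≤ (4 + M) * (1 / m) ^ 2 := by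
  have hinj : Function.Injective fun i : ℕ => (2 * (g * m + i), j) := by
    intro i i' hii; simp only [Prod.mk.injEq, and_true] at hii; omega
  have := Standardized.sq_mean_moments hα hM
    (fun i => W (2 * (g * m + i), j)) (fun i => hm _) (hi.precomp hinj) (Finset.range m)
    (Finset.nonempty_range_iff.2 (by omega))
    (fun i hi' => hs _ (by have := Finset.mem_range.1 hi'; rw [add_mul] at hgh; omega) j)
  rwa [Finset.card_range] at this

theorem iIndepFun_oddSum (hm : ∀ q, Measurable (W q)) (hi : ProbabilityTheory.iIndepFun W μ)
    (N : ℕ) :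
    ProbabilityTheory.iIndepFun (fun j ω => oddSum N (fun q => W q ω) j) μ := by
  refine iIndepFun_of_color W hm hi (fun q => q.2)
    (fun j => (Finset.range N).image fun i => (2 * i + 1, j)) ?_
    (fun j x => oddSum N x j) (fun j => measurable_oddSum N j) ?_
  · intro j q hq
    obtain ⟨i, -, rfl⟩ := Finset.mem_image.1 hq
    rfl
  · intro j x y hxy
    unfold oddSum
    congr 1
    exact Finset.sum_congr rfl fun i hi => hxy _ (Finset.mem_image_of_mem _ hi)

theorem iIndepFun_evenMean (hm : ∀ q, Measurable (W q)) (hi : ProbabilityTheory.iIndepFun W μ)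
    (m g : ℕ) :
    ProbabilityTheory.iIndepFun (fun j ω => evenMean m g (fun q => W q ω) j) μ := by
  refine iIndepFun_of_color W hm hi (fun q => q.2)
    (fun j => (Finset.range m).image fun i => (2 * (g * m + i), j)) ?_
    (fun j x => evenMean m g x j) (fun j => measurable_evenMean m g j) ?_
  · intro j q hq
    obtain ⟨i, -, rfl⟩ := Finset.mem_image.1 hq
    rfl
  · intro j x y hxy
    unfold evenMean
    congr 1
    exact Finset.sum_congr rfl fun i hi => hxy _ (Finset.mem_image_of_mem _ hi)

theorem iIndepFun_blocks (hm : ∀ q, Measurable (W q)) (hi : ProbabilityTheory.iIndepFun W μ)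
    (m : ℕ) (A : Finset (Fin p)) (c : ℝ) :
    ProbabilityTheory.iIndepFun
      (fun g ω => ∑ j ∈ A, (evenMean m g (fun q => W q ω) j ^ 2 - c)) μ := by
  refine iIndepFun_of_color W hm hi (fun q => q.1 / 2 / m)
    (fun g => (Finset.range m ×ˢ Finset.univ).image fun i => (2 * (g * m + i.1), i.2)) ?_
    (fun g x => ∑ j ∈ A, (evenMean m g x j ^ 2 - c)) (fun g => ?_) ?_
  · intro g q hq
    obtain ⟨i, hi', rfl⟩ := Finset.mem_image.1 hq
    have hlt := Finset.mem_range.1 (Finset.mem_product.1 hi').1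
    simp only
    rw [Nat.mul_div_cancel_left _ (by norm_num), mul_comm g m, Nat.mul_add_div (by omega),
      Nat.div_eq_of_lt hlt, add_zero]
  · exact Finset.measurable_sum _ fun j _ => ((measurable_evenMean m g j).pow_const 2).sub_const _
  · intro g x y hxy
    refine Finset.sum_congr rfl fun j _ => ?_
    have : evenMean m g x j = evenMean m g y j := by
      unfold evenMean
      congr 1
      exact Finset.sum_congr rfl fun i hi => hxy _ (Finset.mem_image.2
        ⟨(i, j), Finset.mem_product.2 ⟨hi, Finset.mem_univ _⟩, rfl⟩)
    rw [this]

theorem measureReal_inter_odd_even (hm : ∀ q, Measurable (W q))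
    (hi : ProbabilityTheory.iIndepFun W μ) (N m G : ℕ)
    {Q R : (ℕ × Fin p → ℝ) → Prop} (hQ : MeasurableSet {x | Q x}) (hR : MeasurableSet {x | R x})
    (hQd : ∀ x y, oddSum N x = oddSum N y → Q x = Q y)
    (hRd : ∀ x y, (∀ g < G, evenMean m g x = evenMean m g y) → R x = R y) :
    μ.real {ω | Q (fun q => W q ω) ∧ R (fun q => W q ω)} =
      μ.real {ω | Q (fun q => W q ω)} * μ.real {ω | R (fun q => W q ω)} := by
  have key := iIndepFun_of_color W hm hi (fun q => decide (q.1 % 2 = 1))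
    (fun b => (Finset.range (2 * N + 2 * (G * m)) ×ˢ Finset.univ).filter
      fun q => decide (q.1 % 2 = 1) = b) (fun b q hq => (Finset.mem_filter.1 hq).2)
    (fun b x => if b then Q x else R x) (by
      intro b; cases b
      · simpa using measurableSet_setOfPred.1 hR
      · simpa using measurableSet_setOfPred.1 hQ) (by
      intro b x y hxy
      cases b
      · simp only [Bool.false_eq_true, if_false]
        refine hRd x y fun g hg => ?_
        funext j
        unfold evenMean
        congr 1
        refine Finset.sum_congr rfl fun i hi => hxy _ ?_
        have := Finset.mem_range.1 hi
        have h1 : g * m + m ≤ G * m := by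
          have := Nat.mul_le_mul_right m hg
          rwa [Nat.succ_mul] at this
        simp only [Finset.mem_filter, Finset.mem_product, Finset.mem_range, Finset.mem_univ,
          and_true, decide_eq_false_iff_not]
        omega
      · simp only [if_true]
        refine hQd x y ?_
        funext j
        unfold oddSum
        congr 1
        refine Finset.sum_congr rfl fun i hi => hxy _ ?_
        have := Finset.mem_range.1 hi
        simp only [Finset.mem_filter, Finset.mem_product, Finset.mem_range, Finset.mem_univ,
          and_true, decide_eq_true_eq]
        omega)
  have h2 := (key.indepFun (i := true) (j := false) (by decide)).measure_inter_preimage_eq_mul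
    {True} {True} (MeasurableSet.singleton _) (MeasurableSet.singleton _)
  have e : ∀ f : Ω → Prop, f ⁻¹' {True} = {ω | f ω} := by
    intro f; ext ω; simp
  simp only [e, if_true, Bool.false_eq_true, if_false] at h2
  rw [measureReal_def, measureReal_def, measureReal_def, ← ENNReal.toReal_mul, ← h2]
  rfl
end

section
variable {Ω : Type*} [MeasurableSpace Ω] {μ : Measure Ω} {p : ℕ} {W : ℕ × Fin p → Ω → ℝ}
  {h : ℕ} {α M : ℝ}

theorem measureReal_lt_block_le (hα : 4 ≤ α) (hM : 0 < M) (hm : ∀ q, Measurable (W q))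
    (hi : ProbabilityTheory.iIndepFun W μ)
    (hs : ∀ i < h, ∀ j, Standardized μ (W (i, j)) α M)
    {m g : ℕ} (hm1 : 1 ≤ m) (hgh : 2 * ((g + 1) * m) ≤ h) (A : Finset (Fin p)) {c : ℝ}
    (hc : 0 < c) :
    μ.real {ω | c < ∑ j ∈ A, (evenMean m g (fun q => W q ω) j ^ 2 - 1 / m)} ≤
      A.card * ((4 + M) * (1 / m) ^ 2) / c ^ 2 := by
  have : IsProbabilityMeasure μ := hi.isProbabilityMeasure
  let T : Fin p → Ω → ℝ := fun j ω => evenMean m g (fun q => W q ω) j ^ 2 - 1 / m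
  have hT : ∀ j, Measurable (T j) := fun j =>
    (((measurable_evenMean m g j).comp (measurable_pi_lambda _ hm)).pow_const 2).sub_const _
  have mom := fun j => evenMean_moments hα hM hm hi hs hm1 hgh j
  have hT2 : ∀ j, MemLp (T j) 2 μ := fun j =>
    (memLp_two_iff_integrable_sq (hT j).aestronglyMeasurable).2 (mom j).2.1
  have hT0 : ∀ j, ∫ ω, T j ω ∂μ = 0 := fun j => by
    simp only [T]
    rw [integral_sub (mom j).1 (integrable_const _), (mom j).2.2.1]
    simp
  have hTi : ProbabilityTheory.iIndepFun T μ :=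
    (iIndepFun_evenMean hm hi m g).comp (fun _ z => z ^ 2 - 1 / m) fun _ => by fun_prop
  have hS2 : MemLp (∑ j ∈ A, T j) 2 μ := memLp_finsetSum' _ fun j _ => hT2 j
  have hS0 : ∫ ω, (∑ j ∈ A, T j) ω ∂μ = 0 := by
    simp only [Finset.sum_apply]
    rw [integral_finsetSum _ fun j _ => (hT2 j).integrable (by norm_num)]
    exact Finset.sum_eq_zero fun j _ => hT0 j
  have hvar : ∫ ω, (∑ j ∈ A, T j) ω ^ 2 ∂μ ≤ A.card * ((4 + M) * (1 / m) ^ 2) := by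
    rw [← ProbabilityTheory.variance_of_integral_eq_zero hS2.aemeasurable hS0,
      ProbabilityTheory.IndepFun.variance_sum (fun j _ => hT2 j)
        (fun j _ j' _ hjj => hTi.indepFun hjj)]
    refine (Finset.sum_le_card_nsmul _ _ _ fun j _ => ?_).trans_eq (nsmul_eq_mul _ _)
    rw [ProbabilityTheory.variance_of_integral_eq_zero (hT j).aemeasurable (hT0 j)]
    exact (mom j).2.2.2
  rw [le_div_iff₀ (by positivity), mul_comm]
  refine le_trans (mul_le_mul_of_nonneg_left (measureReal_mono ?_ (measure_ne_top _ _))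
    (by positivity)) ((mul_meas_ge_le_integral_of_nonneg (ae_of_all _ fun ω =>
      sq_nonneg ((∑ j ∈ A, T j) ω)) hS2.integrable_sq (c ^ 2)).trans hvar)
  intro ω hω
  simp only [Set.mem_ofPred_eq, Finset.sum_apply, T] at hω ⊢
  exact pow_le_pow_left₀ hc.le hω.le 2

theorem measureReal_half_blocks_le (hα : 4 ≤ α) (hM : 0 < M) (hm : ∀ q, Measurable (W q))
    (hi : ProbabilityTheory.iIndepFun W μ)
    (hs : ∀ i < h, ∀ j, Standardized μ (W (i, j)) α M)
    {N m G s : ℕ} (hm1 : 1 ≤ m) (hGm : G * m = N) (hNh : 2 * N ≤ h) (a : ℝ) {c q : ℝ} (hc : 0 < c)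
    (hq : s * ((4 + M) * (1 / m) ^ 2) / c ^ 2 ≤ q) :
    μ.real {ω | G ≤ 2 * (Finset.univ.filter fun g : Fin G => c < ∑ j,
        (evenMean m g (fun q => W q ω) j ^ 2 - 1 / m) *
          (if a ≤ |oddSum N (fun q => W q ω) j| then 1 else 0)).card} ≤
      μ.real {ω | s ≤ (Finset.univ.filter fun j => a ≤ |oddSum N (fun q => W q ω) j|).card} +
        2 ^ G * q ^ ((G + 1) / 2) := by
  have : IsProbabilityMeasure μ := hi.isProbabilityMeasure
  let B : (ℕ × Fin p → ℝ) → Finset (Fin p) := fun x =>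
    Finset.univ.filter fun j => a ≤ |oddSum N x j|
  let R : Finset (Fin p) → (ℕ × Fin p → ℝ) → Prop := fun A x =>
    (G + 1) / 2 ≤ (Finset.univ.filter fun g : Fin G =>
      ∑ j ∈ A, (evenMean m g x j ^ 2 - 1 / m) ∈ Set.Ioi c).card
  let w : Ω → ℕ × Fin p → ℝ := fun ω q => W q ω
  have hw : Measurable w := measurable_pi_lambda _ hm
  have hB : ∀ A, MeasurableSet {x | B x = A} := by
    intro A
    have : {x | B x = A} = ⋂ j, {x | a ≤ |oddSum N x j| ↔ j ∈ A} := by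
      ext x; simp [B, Finset.ext_iff]
    rw [this]
    refine MeasurableSet.iInter fun j => ?_
    have hj : MeasurableSet {x : ℕ × Fin p → ℝ | a ≤ |oddSum N x j|} :=
      measurableSet_le measurable_const (measurable_oddSum N j).abs
    by_cases hjA : j ∈ A
    · simpa [hjA] using hj
    · simp only [hjA, iff_false]
      exact hj.compl
  have hR : ∀ A, MeasurableSet {x | R A x} := by
    intro A
    have hmc : Measurable fun x : ℕ × Fin p → ℝ => ∑ g : Fin G,
        if ∑ j ∈ A, (evenMean m g x j ^ 2 - 1 / m) ∈ Set.Ioi c then 1 else 0 := by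
      refine Finset.measurable_sum _ fun g _ => Measurable.ite ?_ measurable_const measurable_const
      exact (Finset.measurable_sum _ fun j _ =>
        ((measurable_evenMean m g j).pow_const 2).sub_const _) measurableSet_Ioi
    simp only [R, Finset.card_filter]
    exact measurableSet_le measurable_const hmc
  have hRq : ∀ A : Finset (Fin p), A.card < s →
      μ.real {ω | R A (w ω)} ≤ 2 ^ G * q ^ ((G + 1) / 2) := by
    intro A hA
    have hq0 : 0 ≤ q := le_trans (by positivity) hq
    refine (measureReal_le_card_filter_le_of_iIndepFun
      (fun (g : Fin G) ω => ∑ j ∈ A, (evenMean m g (w ω) j ^ 2 - 1 / m))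
      ((iIndepFun_blocks hm hi m A (1 / m)).precomp Fin.val_injective)
      (fun _ => Set.Ioi c) (fun _ => measurableSet_Ioi) q (fun g => ?_) ((G + 1) / 2)).trans ?_
    · refine (measureReal_lt_block_le hα hM hm hi hs hm1 ?_ A hc).trans (le_trans ?_ hq)
      · have := Nat.mul_le_mul_right m (Nat.succ_le_of_lt g.2)
        have h2 : (g.1 + 1) * m ≤ G * m := this
        omega
      · gcongr
    · rw [Fintype.card_fin]
      refine mul_le_mul_of_nonneg_right ?_ (by positivity)
      exact_mod_cast Nat.choose_le_two_pow _ _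
  have hsub : {ω | G ≤ 2 * (Finset.univ.filter fun g : Fin G => c < ∑ j,
        (evenMean m g (fun q => W q ω) j ^ 2 - 1 / m) *
          (if a ≤ |oddSum N (fun q => W q ω) j| then 1 else 0)).card} ⊆
      {ω | s ≤ (B (w ω)).card} ∪ ⋃ A ∈ (Finset.univ.filter fun A : Finset (Fin p) => A.card < s),
        {ω | B (w ω) = A ∧ R A (w ω)} := by
    intro ω hω
    rcases le_or_gt s (B (w ω)).card with hB | hB
    · exact Or.inl hB
    · refine Or.inr (Set.mem_iUnion₂.2 ⟨B (w ω), by simpa using hB, rfl, ?_⟩)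
      have e : ∀ g : Fin G, ∑ j ∈ B (w ω), (evenMean m g (w ω) j ^ 2 - 1 / m) = ∑ j,
          (evenMean m g (fun q => W q ω) j ^ 2 - 1 / m) *
          (if a ≤ |oddSum N (fun q => W q ω) j| then 1 else 0) := by
        intro g
        simp only [B, Finset.sum_filter, mul_ite, mul_one, mul_zero, w]
      simp only [R, e, Set.mem_Ioi]
      simp only [Set.mem_ofPred_eq] at hω
      omega
  have hsum : ∑ A ∈ (Finset.univ.filter fun A : Finset (Fin p) => A.card < s),
      μ.real {ω | B (w ω) = A} ≤ 1 := by
    rw [← measureReal_biUnion_finset]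
    · exact measureReal_le_one
    · intro A _ A' _ hAA
      refine Set.disjoint_left.2 fun ω h1 h2 => hAA ?_
      simp only [Set.mem_ofPred_eq] at h1 h2
      rw [← h1, ← h2]
    · exact fun A _ => hw (hB A)
  refine (measureReal_mono hsub (measure_ne_top _ _)).trans
    ((measureReal_union_le _ _).trans (add_le_add le_rfl ?_))
  refine (measureReal_biUnion_finset_le _ _).trans ?_
  have hq0 : 0 ≤ q := le_trans (by positivity) hq
  calc _ ≤ ∑ A ∈ (Finset.univ.filter fun A : Finset (Fin p) => A.card < s),
      μ.real {ω | B (w ω) = A} * (2 ^ G * q ^ ((G + 1) / 2)) := by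
        refine Finset.sum_le_sum fun A hA => ?_
        have := measureReal_inter_odd_even hm hi N m G (hB A) (hR A)
          (fun x y hxy => by simp only [B, hxy]) (fun x y hxy => by
            have : ∀ g : Fin G, evenMean m g x = evenMean m g y := fun g => hxy g g.2
            simp only [R, this])
        refine this.trans_le (mul_le_mul_of_nonneg_left (hRq A ?_) measureReal_nonneg)
        exact (Finset.mem_filter.1 hA).2
    _ ≤ _ := by
        rw [← Finset.sum_mul]
        exact mul_le_of_le_one_left (by positivity) hsum

theorem measureReal_le_card_oddSum_le (hm : ∀ q, Measurable (W q))
    (hi : ProbabilityTheory.iIndepFun W μ) (N s : ℕ) (a : ℝ) {q : ℝ}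
    (hq : ∀ j, μ.real {ω | a ≤ |oddSum N (fun q => W q ω) j|} ≤ q) :
    μ.real {ω | s ≤ (Finset.univ.filter fun j => a ≤ |oddSum N (fun q => W q ω) j|).card} ≤
      (p.choose s : ℝ) * q ^ s := by
  have := measureReal_le_card_filter_le_of_iIndepFun
    (fun j ω => oddSum N (fun q => W q ω) j) (iIndepFun_oddSum hm hi N)
    (fun _ => {x | a ≤ |x|}) (fun _ => measurableSet_le measurable_const measurable_abs) q hq s
  simpa using this

theorem measureReal_lt_first_le (hα : 4 ≤ α)
    [IsProbabilityMeasure μ] (hs : ∀ j, Standardized μ (W (0, j)) α M)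
    {a c : ℝ} (ha : 0 < a) (hc : 0 < c) :
    μ.real {ω | c < ∑ j, (W (0, j) ω ^ 2 - 1) * (if a ≤ |W (0, j) ω| then 1 else 0)} ≤
      p * (M / a ^ (α - 2)) / c := by
  have ha2 : 0 < a ^ (α - 2) := Real.rpow_pos_of_pos ha _
  have hi : Integrable (fun ω => ∑ j, |W (0, j) ω| ^ α / a ^ (α - 2)) μ :=
    integrable_finsetSum _ fun j _ => (hs j).int_alpha.div_const _
  rw [le_div_iff₀ hc, mul_comm]
  refine le_trans (mul_le_mul_of_nonneg_left (measureReal_mono ?_ (measure_ne_top _ _)) hc.le)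
    ((mul_meas_ge_le_integral_of_nonneg (ae_of_all _ fun ω =>
      Finset.sum_nonneg fun j _ => by positivity) hi c).trans ?_)
  · intro ω hω
    rw [Set.mem_ofPred_eq] at hω
    refine hω.le.trans (Finset.sum_le_sum fun j _ => ?_)
    split_ifs with h
    · rw [mul_one, le_div_iff₀ ha2]
      have h0 : 0 < |W (0, j) ω| := ha.trans_le h
      have h1 : a ^ (α - 2) ≤ |W (0, j) ω| ^ (α - 2) :=
        Real.rpow_le_rpow ha.le h (by linarith)
      have h2 : |W (0, j) ω| ^ α = |W (0, j) ω| ^ (α - 2) * W (0, j) ω ^ 2 := by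
        rw [← sq_abs (W (0, j) ω), ← Real.rpow_natCast, ← Real.rpow_add h0]
        norm_num
      rw [h2]
      nlinarith [sq_nonneg (W (0, j) ω)]
    · rw [mul_zero]; positivity
  · rw [integral_finsetSum _ fun j _ => (hs j).int_alpha.div_const _]
    refine (Finset.sum_le_card_nsmul _ _ (M / a ^ (α - 2)) fun j _ => ?_).trans_eq (by simp)
    rw [integral_div]
    exact div_le_div_of_nonneg_right (hs j).alpha ha2.le
end

theorem one_le_LL {n : ℕ} (hn : 2 ≤ n) : 1 ≤ LL n := by
  have hn' : (2 : ℝ) ≤ n := by exact_mod_cast hn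
  have h2 : Real.exp 1 ≤ Real.log (8 * n) := by
    calc Real.exp 1 ≤ 4 * Real.log 2 := by
          linarith [Real.exp_one_lt_d9, Real.log_two_gt_d9]
      _ = Real.log (2 ^ 4) := by rw [Real.log_pow]; norm_num
      _ ≤ _ := Real.log_le_log (by norm_num) (by linarith)
  exact (Real.le_log_iff_exp_le ((Real.exp_pos 1).trans_le h2)).2 h2

theorem log_eight_mul_pos {n : ℕ} (hn : 2 ≤ n) : 0 < Real.log (8 * n) := by
  have hn' : (2 : ℝ) ≤ n := by exact_mod_cast hn
  exact Real.log_pos (by linarith)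

theorem exp_neg_LL {n : ℕ} (hn : 2 ≤ n) : Real.exp (-LL n) = (Real.log (8 * n))⁻¹ := by
  rw [LL, Real.exp_neg, Real.exp_log (log_eight_mul_pos hn)]

theorem natLog_mul_exp_neg_LL_le {n : ℕ} (hn : 2 ≤ n) :
    (Nat.log 2 (n / 2) : ℝ) * Real.exp (-LL n) ≤ 2 := by
  rw [exp_neg_LL hn, ← div_eq_mul_inv, div_le_iff₀ (log_eight_mul_pos hn)]
  have h1 : ((2 ^ Nat.log 2 (n / 2) : ℕ) : ℝ) ≤ 8 * n := by
    have := Nat.pow_log_le_self 2 (x := n / 2) (by omega)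
    have h2 : 2 ^ Nat.log 2 (n / 2) ≤ 8 * n := by omega
    exact_mod_cast h2
  have h3 := Real.log_le_log (by positivity) h1
  rw [Nat.cast_pow, Real.log_pow] at h3
  have := Real.log_two_gt_d9
  have h4 : (0 : ℝ) ≤ Nat.log 2 (n / 2) := Nat.cast_nonneg _
  push_cast at h3
  nlinarith

theorem exists_deltaSparse_eq {n : ℕ} (hn : 2 ≤ n) :
    ∃ d : ℕ, 4 ≤ d ∧ DeltaSparse n = 2 ^ d ∧ 16 * LL n ≤ DeltaSparse n ∧
      (DeltaSparse n : ℝ) ≤ 32 * LL n := by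
  have hL := one_le_LL hn
  have hL0 : 0 < LL n := by linarith
  refine ⟨_, Nat.le_add_right 4 _, rfl, ?_⟩
  have hlog : 0 ≤ Real.logb 2 (LL n) := Real.logb_nonneg (by norm_num) hL
  set c := (⌈Real.logb 2 (LL n)⌉).toNat with hc
  have hcr : (c : ℝ) = ⌈Real.logb 2 (LL n)⌉ := by
    have := Int.toNat_of_nonneg (Int.ceil_nonneg hlog)
    exact_mod_cast congrArg (Int.cast : ℤ → ℝ) this
  have h1 : Real.logb 2 (LL n) ≤ c := hcr ▸ Int.le_ceil _
  have h2 : (c : ℝ) < Real.logb 2 (LL n) + 1 := hcr ▸ Int.ceil_lt_add_one _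
  have h1' : LL n ≤ 2 ^ c := by
    rw [Real.logb_le_iff_le_rpow (by norm_num) hL0, Real.rpow_natCast] at h1
    exact h1
  have h2' : (2 : ℝ) ^ c ≤ 2 * LL n := by
    have h3 := Real.rpow_le_rpow_of_exponent_le (by norm_num : (1 : ℝ) ≤ 2) h2.le
    rw [Real.rpow_natCast, Real.rpow_add (by norm_num),
      Real.rpow_logb (by norm_num) (by norm_num) hL0] at h3
    linarith [Real.rpow_one (2 : ℝ)]
  unfold DeltaSparse
  push_cast
  rw [← hc, pow_add]
  constructor <;> linarith

theorem exists_group_eq {n : ℕ} (hn : 2 ≤ n) (k : ℕ) :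
    ∃ m : ℕ, 1 ≤ m ∧ 1 ≤ min (2 ^ (k + 1)) (DeltaSparse n) / 2 ∧
      min (2 ^ (k + 1)) (DeltaSparse n) / 2 * m = 2 ^ k ∧
      ((min (2 ^ (k + 1)) (DeltaSparse n) / 2 : ℕ) : ℝ) ≤ 16 * LL n ∧
      (k + 1 ≤ min (2 ^ (k + 1)) (DeltaSparse n) / 2 ∨
        8 * LL n ≤ ((min (2 ^ (k + 1)) (DeltaSparse n) / 2 : ℕ) : ℝ)) := by
  obtain ⟨d, hd4, hd, h16, h32⟩ := exists_deltaSparse_eq hn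
  have hhalf : ∀ i, 2 ^ (i + 1) / 2 = 2 ^ i := fun i => by rw [pow_succ]; omega
  obtain ⟨e, rfl⟩ : ∃ e, d = e + 1 := ⟨d - 1, by omega⟩
  have he : ((2 ^ e : ℕ) : ℝ) = (DeltaSparse n : ℝ) / 2 := by
    rw [hd]; push_cast; ring
  rcases le_total (k + 1) (e + 1) with h | h
  · have hmin : min (2 ^ (k + 1)) (DeltaSparse n) / 2 = 2 ^ k := by
      rw [hd, min_eq_left (Nat.pow_le_pow_right (by norm_num) h), hhalf]
    rw [hmin]
    refine ⟨1, le_rfl, Nat.one_le_two_pow, mul_one _, ?_, Or.inl Nat.lt_two_pow_self⟩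
    have : ((2 ^ k : ℕ) : ℝ) ≤ ((2 ^ e : ℕ) : ℝ) := by
      exact_mod_cast Nat.pow_le_pow_right (by norm_num) (by omega)
    linarith
  · have hmin : min (2 ^ (k + 1)) (DeltaSparse n) / 2 = 2 ^ e := by
      rw [hd, min_eq_right (Nat.pow_le_pow_right (by norm_num) h), hhalf]
    rw [hmin]
    refine ⟨2 ^ (k - e), Nat.one_le_two_pow, Nat.one_le_two_pow, ?_, ?_, Or.inr ?_⟩
    · rw [← pow_add]; congr 1; omega
    · linarith
    · linarith

theorem one_le_div_rpow {p s : ℕ} (hs : 1 ≤ s) (hsp : s ≤ p) {β : ℝ} (hβ : 0 ≤ β) :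
    1 ≤ ((p : ℝ) / s) ^ β := by
  refine Real.one_le_rpow ?_ hβ
  have : (0 : ℝ) < s := by exact_mod_cast hs
  rw [one_le_div this]
  exact_mod_cast hsp

/-- The threshold level `C ((p/s)^{1/α} + s^{-1/2} √L)`. -/
noncomputable def level (p s : ℕ) (α C L : ℝ) : ℝ :=
  C * (((p : ℝ) / (s : ℝ)) ^ ((1 : ℝ) / α) + ((s : ℝ) ^ (-(1 : ℝ) / 2)) * Real.sqrt L)

section
variable {p s : ℕ} {α C L : ℝ}

theorem le_level (hC : 0 ≤ C) :
    C * ((p : ℝ) / s) ^ ((1 : ℝ) / α) ≤ level p s α C L := by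
  refine mul_le_mul_of_nonneg_left ?_ hC
  have : 0 ≤ ((s : ℝ) ^ (-(1 : ℝ) / 2)) * √L := by positivity
  linarith

theorem level_pos (hα : 0 < α) (hC : 0 < C) (hs : 1 ≤ s) (hsp : s ≤ p) :
    0 < level p s α C L := by
  have h1 := one_le_div_rpow hs hsp (β := 1 / α) (by positivity)
  exact lt_of_lt_of_le (by positivity) (le_level hC.le)

theorem rpow_neg_half_mul_sqrt_sq (hs : 1 ≤ s) (hL : 0 ≤ L) :
    ((s : ℝ) ^ (-(1 : ℝ) / 2) * √L) ^ 2 = L / s := by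
  have hs0 : (0 : ℝ) < s := by exact_mod_cast hs
  rw [mul_pow, Real.sq_sqrt hL, ← Real.rpow_natCast, ← Real.rpow_mul hs0.le]
  norm_num [Real.rpow_neg_one]
  ring

theorem div_rpow_inv_sq :
    (((p : ℝ) / s) ^ ((1 : ℝ) / α)) ^ 2 = ((p : ℝ) / s) ^ ((2 : ℝ) / α) := by
  rw [← Real.rpow_natCast, ← Real.rpow_mul (by positivity)]
  congr 1
  push_cast; ring

theorem level_sq_ge (hs : 1 ≤ s) (hL : 0 ≤ L) :
    C ^ 2 * (((p : ℝ) / s) ^ ((2 : ℝ) / α) + L / s) ≤ level p s α C L ^ 2 := by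
  rw [level, mul_pow, ← rpow_neg_half_mul_sqrt_sq hs hL, ← div_rpow_inv_sq]
  refine mul_le_mul_of_nonneg_left ?_ (sq_nonneg _)
  have h1 : 0 ≤ ((p : ℝ) / s) ^ ((1 : ℝ) / α) := by positivity
  have h2 : 0 ≤ ((s : ℝ) ^ (-(1 : ℝ) / 2)) * √L := by positivity
  nlinarith [mul_nonneg h1 h2]

theorem level_sq_le (hs : 1 ≤ s) (hL : 0 ≤ L) :
    level p s α C L ^ 2 ≤ 2 * C ^ 2 * (((p : ℝ) / s) ^ ((2 : ℝ) / α) + L / s) := by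
  rw [level, mul_pow, ← rpow_neg_half_mul_sqrt_sq hs hL, ← div_rpow_inv_sq]
  have := add_sq_le (a := ((p : ℝ) / s) ^ ((1 : ℝ) / α)) (b := ((s : ℝ) ^ (-(1 : ℝ) / 2)) * √L)
  nlinarith [sq_nonneg C]

theorem le_level_rpow (hα : 1 ≤ α) (hC : 1 ≤ C) : C * ((p : ℝ) / s) ≤ level p s α C L ^ α := by
  have hR : 0 ≤ (p : ℝ) / s := by positivity
  calc C * ((p : ℝ) / s) ≤ C ^ α * ((p : ℝ) / s) := by
        refine mul_le_mul_of_nonneg_right ?_ hR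
        simpa using Real.rpow_le_rpow_of_exponent_le hC hα
    _ = (C * ((p : ℝ) / s) ^ ((1 : ℝ) / α)) ^ α := by
        rw [Real.mul_rpow (by linarith) (by positivity), ← Real.rpow_mul hR,
          one_div_mul_cancel (by linarith), Real.rpow_one]
    _ ≤ _ := Real.rpow_le_rpow (by positivity) (le_level (by linarith)) (by linarith)

/-- The two-term tail bound at the threshold level. -/
noncomputable def tailBound (α M : ℝ) (N : ℕ) (a : ℝ) : ℝ :=
  8 * 2 ^ α * M * (1 / (N * a ^ α)) + 6 * Real.exp (-(a ^ 2 / (4 * Real.exp α)))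

theorem exists_level_const (α M δ : ℝ) (hα : 4 ≤ α) (hM : 0 < M) (hδ : 0 < δ) :
    ∃ C : ℝ, 1 ≤ C ∧ ∀ (p s N : ℕ) (L : ℝ), 1 ≤ s → s ≤ p → 1 ≤ N → 0 ≤ L →
      Real.exp 1 * ((p : ℝ) / s) * tailBound α M N (level p s α C L) ≤
        δ / N + δ * Real.exp (-(L / s)) := by
  have he := Real.exp_pos 1
  set κ := 4 * Real.exp α with hκ
  have hκ0 : 0 < κ := by positivity
  set c1 := Real.exp 1 * (8 * 2 ^ α * M) / δ with hc1
  set c2 := Real.exp 1 * 6 / δ with hc2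
  have h1 : 0 < c1 := by positivity
  have h2 : 0 < c2 := by positivity
  refine ⟨κ + c1 + α / 2 + c2 + 1, by linarith, ?_⟩
  set C := κ + c1 + α / 2 + c2 + 1 with hC
  have hC1 : 1 ≤ C := by linarith
  intro p s N L hs hsp hN hL
  have hs0 : (0 : ℝ) < s := by exact_mod_cast hs
  have hN0 : (0 : ℝ) < N := by exact_mod_cast hN
  have hR1 : 1 ≤ (p : ℝ) / s := by
    rw [one_le_div hs0]; exact_mod_cast hsp
  set R := (p : ℝ) / s with hR
  have hA := le_level_rpow (p := p) (s := s) (L := L) (by linarith : 1 ≤ α) hC1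
  have hB := level_sq_ge (p := p) (s := s) (C := C) (α := α) hs hL
  set a := level p s α C L with ha
  rw [← hR] at hA hB
  set u := R ^ ((2 : ℝ) / α) with hu
  have hu1 : 1 ≤ u := one_le_div_rpow hs hsp (by positivity)
  have haα : 0 < a ^ α := lt_of_lt_of_le (by positivity) hA
  rw [tailBound, mul_add]
  refine add_le_add ?_ ?_
  · have : Real.exp 1 * R * (8 * 2 ^ α * M * (1 / (N * a ^ α))) = c1 * δ * R / (N * a ^ α) := by
      rw [hc1]; field_simp
    rw [this, div_le_div_iff₀ (by positivity) hN0]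
    have h3 : c1 * R ≤ a ^ α := le_trans (mul_le_mul_of_nonneg_right (by linarith) (by linarith)) hA
    have h4 := mul_le_mul_of_nonneg_left h3 (mul_pos hδ hN0).le
    linarith
  · have hCκ : C * (u + L / s) ≤ a ^ 2 / κ := by
      rw [le_div_iff₀ hκ0]
      refine le_trans ?_ hB
      have h3 : 0 ≤ L / s := by positivity
      have h4 : κ ≤ C := by linarith
      have h5 := mul_le_mul_of_nonneg_left h4 (by positivity : 0 ≤ C * (u + L / s))
      linarith
    have hRu : R ≤ Real.exp (α / 2 * u) := by
      have h5 : R = u ^ (α / 2) := by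
        rw [hu, ← Real.rpow_mul (by linarith)]
        have : 2 / α * (α / 2) = 1 := by field_simp
        rw [this, Real.rpow_one]
      rw [h5, Real.rpow_def_of_pos (by linarith), mul_comm]
      refine Real.exp_le_exp.2 (mul_le_mul_of_nonneg_left ?_ (by linarith))
      linarith [Real.log_le_sub_one_of_pos (by linarith : 0 < u)]
    have hexp : R * Real.exp (-(a ^ 2 / κ)) ≤ c2⁻¹ * Real.exp (-(L / s)) := by
      calc R * Real.exp (-(a ^ 2 / κ))
          ≤ Real.exp (α / 2 * u) * Real.exp (-(C * (u + L / s))) := by gcongr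
        _ = Real.exp (-((C - α / 2) * u)) * Real.exp (-(C * (L / s))) := by
            rw [← Real.exp_add, ← Real.exp_add]; ring_nf
        _ ≤ c2⁻¹ * Real.exp (-(L / s)) := by
            have h3 : 0 ≤ L / s := by positivity
            refine mul_le_mul ?_ (Real.exp_le_exp.2 (neg_le_neg (le_mul_of_one_le_left h3 hC1))) (Real.exp_pos _).le
              (by positivity)
            rw [Real.exp_neg]
            refine inv_anti₀ h2 ?_
            have h6 := Real.add_one_le_exp ((C - α / 2) * u)
            have h7 : c2 * 1 ≤ (C - α / 2) * u :=
              mul_le_mul (by linarith) hu1 (by linarith) (by linarith)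
            linarith
    calc Real.exp 1 * R * (6 * Real.exp (-(a ^ 2 / κ)))
        = Real.exp 1 * 6 * (R * Real.exp (-(a ^ 2 / κ))) := by ring
      _ ≤ Real.exp 1 * 6 * (c2⁻¹ * Real.exp (-(L / s))) := by gcongr
      _ = δ * Real.exp (-(L / s)) := by rw [hc2]; field_simp

theorem choose_mul_pow_le {p s : ℕ} (hs : 1 ≤ s) {x : ℝ} (hx : 0 ≤ x) :
    (p.choose s : ℝ) * x ^ s ≤ (Real.exp 1 * ((p : ℝ) / s) * x) ^ s := by
  have hs0 : (0 : ℝ) < s := by exact_mod_cast hs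
  rw [mul_pow]
  refine mul_le_mul_of_nonneg_right ?_ (by positivity)
  have h1 : (p.choose s : ℝ) ≤ (p : ℝ) ^ s / s.factorial := Nat.choose_le_pow_div s p
  have h2 := Real.pow_div_factorial_le_exp (s : ℝ) hs0.le s
  refine h1.trans ?_
  rw [mul_pow, div_pow, ← Real.exp_nat_mul, mul_one]
  calc (p : ℝ) ^ s / s.factorial = (s : ℝ) ^ s / s.factorial * ((p : ℝ) ^ s / (s : ℝ) ^ s) := by
        field_simp
    _ ≤ _ := by gcongr

theorem choose_mul_pow_le_of_le {p s N : ℕ} {δ L x : ℝ} (hs : 1 ≤ s) (hN : 1 ≤ N) (hx : 0 ≤ x)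
    (hδ : 0 < δ) (hδ1 : 2 * δ ≤ 1)
    (h : Real.exp 1 * ((p : ℝ) / s) * x ≤ δ / N + δ * Real.exp (-(L / s))) :
    (p.choose s : ℝ) * x ^ s ≤ 2 * δ / N + 2 * δ * Real.exp (-L) := by
  have hs0 : (0 : ℝ) < s := by exact_mod_cast hs
  have hN1 : (1 : ℝ) ≤ N := by exact_mod_cast hN
  have hy : 0 ≤ δ * Real.exp (-(L / s)) := by positivity
  have hz : 0 ≤ δ / N := by positivity
  have hz1 : (2 * (δ / N)) ^ s ≤ 2 * δ / N := by
    have h1 : 2 * (δ / N) ≤ 1 := by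
      rw [← mul_div_assoc]
      exact (div_le_self (by positivity) hN1).trans hδ1
    refine (pow_le_of_le_one (by positivity) h1 (by omega)).trans_eq (by ring)
  have hy1 : (2 * (δ * Real.exp (-(L / s)))) ^ s ≤ 2 * δ * Real.exp (-L) := by
    rw [← mul_assoc, mul_pow, ← Real.exp_nat_mul]
    have : (s : ℝ) * -(L / s) = -L := by field_simp
    rw [this]
    exact mul_le_mul_of_nonneg_right (pow_le_of_le_one (by positivity) hδ1 (by omega))
      (Real.exp_pos _).le
  refine (choose_mul_pow_le hs hx).trans ?_
  calc _ ≤ (2 * max (δ / N) (δ * Real.exp (-(L / s)))) ^ s := by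
        refine pow_le_pow_left₀ (by positivity) (h.trans ?_) s
        linarith [le_max_left (δ / N) (δ * Real.exp (-(L / s))),
          le_max_right (δ / N) (δ * Real.exp (-(L / s)))]
    _ ≤ _ := by
        have h0 : 0 ≤ 2 * δ / N := by positivity
        have h00 : 0 ≤ 2 * δ * Real.exp (-L) := by positivity
        rcases max_choice (δ / N) (δ * Real.exp (-(L / s))) with h | h <;> rw [h] <;> linarith
end

/-- The hard-thresholded median-of-means statistic in terms of the symmetrized rows. -/
noncomputable def momStat {p : ℕ} (N m G : ℕ) (a : ℝ) (x : ℕ × Fin p → ℝ) : ℝ :=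
  N * median (List.ofFn fun g : Fin G => ∑ j, (evenMean m g x j ^ 2 - 1 / m) *
    (if a ≤ |oddSum N x j| then 1 else 0))

/-- The hard-thresholded statistic of the first symmetrized row. -/
noncomputable def firstStat {p : ℕ} (a : ℝ) (x : ℕ × Fin p → ℝ) : ℝ :=
  ∑ j, (x (0, j) ^ 2 - 1) * (if a ≤ |x (0, j)| then 1 else 0)

theorem AMoMa_one_eq (p n : ℕ) (hn : 2 ≤ n) (X : Fin n → Fin p → ℝ) (G : ℕ) (a : ℝ) :
    AMoMa p n X 1 G a = firstStat a fun q => halfDiff p n q X := by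
  have h : 0 < n / 2 := by omega
  simp [AMoMa, firstStat, halfDiff, h]

theorem AMoMa_eq (p n : ℕ) (X : Fin n → Fin p → ℝ) {N m G : ℕ} (hm : 1 ≤ m) (hN : 1 ≤ N)
    (hG : G * m = N) (hn : 2 * N ≤ n / 2) (a : ℝ) :
    AMoMa p n X (2 * N) G a = momStat N m G a fun q => halfDiff p n q X := by
  have hG0 : 0 < G := by
    rcases Nat.eq_zero_or_pos G with h | h
    · simp [h] at hG; omega
    · exact h
  have hdiv : 2 * N / (2 * G) = m := by
    rw [← hG, ← mul_assoc, Nat.mul_div_cancel_left _ (by omega)]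
  have hN0 : (0 : ℝ) < N := by exact_mod_cast hN
  have hY : ∀ j, Yt2 p n X (2 * N) j = oddSum N (fun q => halfDiff p n q X) j := by
    intro j
    have h2 : 2 * N / 2 = N := by omega
    rw [Yt2, oddSum, h2, Nat.cast_mul, Real.sqrt_mul (by positivity), Nat.cast_ofNat, ← div_div,
      Finset.sum_div]
    congr 1
    refine Finset.sum_congr rfl fun i hi => ?_
    have hi' := Finset.mem_range.1 hi
    have hlt : 2 * i + 1 < n / 2 := by omega
    have e : n - 1 - (2 * i + 1) = n - 2 - 2 * i := by omega
    simp only [halfDiff, hlt, if_true, Zb, e]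
  have hE : ∀ (g : Fin G) j, groupMeanOdd p n X (2 * N) G g j =
      evenMean m g (fun q => halfDiff p n q X) j := by
    intro g j
    rw [groupMeanOdd, evenMean, hdiv]
    congr 1
    refine Finset.sum_congr rfl fun i hi => ?_
    have hi' := Finset.mem_range.1 hi
    have := Nat.mul_le_mul_right m (Nat.succ_le_of_lt g.2)
    rw [Nat.succ_mul] at this
    have hlt : 2 * (g.1 * m + i) < n / 2 := by omega
    simp only [halfDiff, hlt, if_true]
  have hc : 2 * (G : ℝ) / ((2 * N : ℕ) : ℝ) = 1 / m := by
    have hGr : (0 : ℝ) < G := by exact_mod_cast hG0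
    have hmr : (0 : ℝ) < m := by exact_mod_cast hm
    rw [← hG]; push_cast; field_simp
  have h1 : 2 * N ≠ 1 := by omega
  have h2 : ((2 * N : ℕ) : ℝ) / 2 = N := by push_cast; ring
  rw [AMoMa, if_neg h1, momStat, h2]
  simp only [hE, hY, hc]

theorem halfDiff_add (p n : ℕ) (q : ℕ × Fin p) (X Y : Fin n → Fin p → ℝ) :
    halfDiff p n q (X + Y) = halfDiff p n q X + halfDiff p n q Y := by
  have hcol : ∀ i j, col p n (X + Y) i j = col p n X i j + col p n Y i j := by
    intro i j
    unfold col
    split_ifs <;> simp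
  unfold halfDiff Zb
  split_ifs
  · rw [hcol, hcol]; ring
  · simp

theorem halfDiff_of_mem_Theta0 {p n : ℕ} {θ : Fin n → Fin p → ℝ} (hθ : θ ∈ Theta0 p n)
    (q : ℕ × Fin p) : halfDiff p n q θ = 0 := by
  obtain ⟨v, hv⟩ := hθ
  unfold halfDiff Zb col
  split_ifs <;> first | omega | simp [hv]

theorem halfDiff_of_mem_ThetaAt {p n t0 i : ℕ} {θ : Fin n → Fin p → ℝ} {v w : Fin p → ℝ}
    (hv : ∀ t : Fin n, (t : ℕ) < t0 → θ t = v) (hw : ∀ t : Fin n, t0 ≤ (t : ℕ) → θ t = w)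
    (hi : i < n / 2) (h1 : i < t0) (h2 : i < n - t0) (j : Fin p) :
    halfDiff p n (i, j) θ = (v j - w j) / √2 := by
  have h3 : i < n := by omega
  have h4 : n - 1 - i < n := by omega
  simp only [halfDiff, hi, if_true, Zb, col, h3, h4, dif_pos]
  rw [hv _ h1, hw ⟨n - 1 - i, h4⟩ (by simp only; omega)]

theorem pow_group_le {b L : ℝ} {k G : ℕ} (hb0 : 0 ≤ b) (hb : b ≤ 1 / 3) (hL : 1 ≤ L)
    (h : k + 1 ≤ G ∨ 8 * L ≤ G) : b ^ G ≤ b ^ (k + 1) + b * Real.exp (-L) := by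
  have he := Real.exp_pos (-L)
  rcases h with h | h
  · exact (pow_le_pow_of_le_one hb0 (by linarith) h).trans (by nlinarith)
  · obtain ⟨g, rfl⟩ : ∃ g, G = g + 1 := ⟨G - 1, by
      have : (0 : ℝ) < G := by linarith
      have : 0 < G := by exact_mod_cast this
      omega⟩
    have hb1 : b ≤ Real.exp (-1) := by
      rw [Real.exp_neg]
      refine hb.trans ?_
      rw [one_div]
      exact inv_anti₀ (Real.exp_pos 1) (by linarith [Real.exp_one_lt_d9])
    have h2 : b ^ g ≤ Real.exp (-L) := by
      refine (pow_le_pow_left₀ hb0 hb1 g).trans ?_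
      rw [← Real.exp_nat_mul]
      refine Real.exp_le_exp.2 ?_
      push_cast at h
      linarith
    rw [pow_succ, mul_comm]
    have := mul_le_mul_of_nonneg_left h2 hb0
    have : 0 ≤ b ^ (k + 1) := by positivity
    linarith

section
variable {Ω : Type*} [MeasurableSpace Ω] {μ : Measure Ω} {p : ℕ} {W : ℕ × Fin p → Ω → ℝ}
  {h : ℕ} {α M : ℝ}

theorem measureReal_lt_momStat_le (hα : 4 ≤ α) (hM : 0 < M) (hm : ∀ q, Measurable (W q))
    (hi : ProbabilityTheory.iIndepFun W μ)
    (hs : ∀ i < h, ∀ j, Standardized μ (W (i, j)) α M)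
    {k m G s : ℕ} {L δ b C₁ C₂ : ℝ} (hm1 : 1 ≤ m) (hG : 1 ≤ G) (hGm : G * m = 2 ^ k)
    (hkh : 2 * 2 ^ k ≤ h) (hs1 : 1 ≤ s) (hsp : s ≤ p) (hL : 1 ≤ L) (hGL : k + 1 ≤ G ∨ 8 * L ≤ G)
    (hδ : 0 < δ) (hδ1 : 2 * δ ≤ 1) (hb0 : 0 < b) (hb : b ≤ 1 / 3) (hC₁ : 0 < C₁)
    (hC : Real.exp 1 * ((p : ℝ) / s) * tailBound α M (2 ^ k) (level p s α C₁ L) ≤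
      δ / (2 ^ k : ℕ) + δ * Real.exp (-(L / s)))
    (hC₂ : 2 * √(4 + M) / b ≤ C₂) :
    μ.real {ω | C₂ * (√s * G) < momStat (2 ^ k) m G (level p s α C₁ L) fun q => W q ω} ≤
      2 * δ * (1 / 2) ^ k + b ^ (k + 1) + (2 * δ + b) * Real.exp (-L) := by
  have hprob : IsProbabilityMeasure μ := hi.isProbabilityMeasure
  have hs0 : (0 : ℝ) < s := by exact_mod_cast hs1
  have hm0 : (0 : ℝ) < m := by exact_mod_cast hm1
  have hG0 : (0 : ℝ) < G := by exact_mod_cast hG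
  have hN1 : 1 ≤ 2 ^ k := Nat.one_le_two_pow
  have hN : ((2 ^ k : ℕ) : ℝ) = G * m := by rw [← hGm]; push_cast; ring
  have hC20 : 0 < C₂ := lt_of_lt_of_le (by positivity) hC₂
  set a := level p s α C₁ L with ha_def
  have ha : 0 < a := level_pos (by linarith) hC₁ hs1 hsp
  set c := C₂ * √s / m with hc_def
  have hc : 0 < c := by positivity
  have hq : s * ((4 + M) * (1 / m) ^ 2) / c ^ 2 ≤ (b / 2) ^ 2 := by
    have hc2 : c ^ 2 = C₂ ^ 2 * s / m ^ 2 := by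
      rw [hc_def, div_pow, mul_pow, Real.sq_sqrt hs0.le]
    rw [hc2]
    have e : s * ((4 + M) * (1 / m) ^ 2) / (C₂ ^ 2 * s / m ^ 2) = (4 + M) / C₂ ^ 2 := by
      field_simp
    rw [e, div_le_iff₀ (by positivity)]
    rw [div_le_iff₀ hb0] at hC₂
    have h2 := pow_le_pow_left₀ (by positivity) hC₂ 2
    rw [mul_pow, Real.sq_sqrt (by linarith)] at h2
    nlinarith
  have key := measureReal_half_blocks_le hα hM hm hi hs hm1 hGm hkh a hc hq
  have hcard := measureReal_le_card_oddSum_le hm hi (2 ^ k) s a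
    (q := tailBound α M (2 ^ k) a) (measureReal_le_oddSum_le hα hM hm hi hs hN1 hkh ha)
  have htb : 0 ≤ tailBound α M (2 ^ k) a := by unfold tailBound; positivity
  have hcard2 := choose_mul_pow_le_of_le hs1 hN1 htb hδ hδ1 hC
  have hpow : (2 : ℝ) ^ G * ((b / 2) ^ 2) ^ ((G + 1) / 2) ≤ b ^ G := by
    calc (2 : ℝ) ^ G * ((b / 2) ^ 2) ^ ((G + 1) / 2) ≤ 2 ^ G * (b / 2) ^ G := by
          rw [← pow_mul]
          exact mul_le_mul_of_nonneg_left
            (pow_le_pow_of_le_one (by positivity) (by linarith) (by omega)) (by positivity)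
      _ = b ^ G := by rw [← mul_pow]; congr 1; ring
  have hbG := pow_group_le hb0.le hb hL hGL
  refine (measureReal_mono (fun ω hω => ?_) (measure_ne_top _ _)).trans (key.trans
    ((add_le_add (hcard.trans hcard2) (hpow.trans hbG)).trans_eq ?_))
  · refine card_lt_of_lt_median hG _ c ?_
    rw [Set.mem_ofPred_eq, momStat, hN] at hω
    rw [hc_def, div_lt_iff₀ hm0]
    refine lt_of_mul_lt_mul_left (a := (G : ℝ)) ?_ hG0.le
    linarith
  · push_cast
    rw [one_div, inv_pow]
    ring

theorem measureReal_lt_firstStat_le (hα : 4 ≤ α) (hM : 0 < M) [IsProbabilityMeasure μ]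
    (hs : ∀ j, Standardized μ (W (0, j)) α M) {s : ℕ} {L C₁ C₂ : ℝ} (hs1 : 1 ≤ s) (hsp : s ≤ p)
    (hC₁ : 1 ≤ C₁) (hC₂ : 0 < C₂) :
    μ.real {ω | C₂ * (s * ((p : ℝ) / s) ^ ((2 : ℝ) / α)) <
      firstStat (level p s α C₁ L) fun q => W q ω} ≤ M / C₂ := by
  have hs0 : (0 : ℝ) < s := by exact_mod_cast hs1
  have hp0 : (0 : ℝ) < p := by exact_mod_cast hs1.trans hsp
  have hR : 0 < (p : ℝ) / s := by positivity
  have ha : 0 < level p s α C₁ L := level_pos (by linarith) (by linarith) hs1 hsp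
  have hu : 0 < ((p : ℝ) / s) ^ ((2 : ℝ) / α) := by positivity
  refine (measureReal_lt_first_le hα hs ha (by positivity)).trans ?_
  have h1 : ((p : ℝ) / s) / ((p : ℝ) / s) ^ ((2 : ℝ) / α) ≤ level p s α C₁ L ^ (α - 2) := by
    calc _ = (((p : ℝ) / s) ^ ((1 : ℝ) / α)) ^ (α - 2) := by
          rw [← Real.rpow_mul hR.le]
          nth_rewrite 1 [← Real.rpow_one ((p : ℝ) / s)]
          rw [← Real.rpow_sub hR]
          congr 1
          field_simp
      _ ≤ _ := by
          refine Real.rpow_le_rpow (by positivity) ?_ (by linarith)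
          refine le_trans ?_ (le_level (by linarith))
          exact le_mul_of_one_le_left (by positivity) hC₁
  rw [div_le_iff₀ hu] at h1
  have h2 : 0 < level p s α C₁ L ^ (α - 2) := Real.rpow_pos_of_pos ha _
  rw [div_le_div_iff₀ (by positivity) hC₂]
  have h3 : (p : ℝ) ≤ level p s α C₁ L ^ (α - 2) * (s * ((p : ℝ) / s) ^ ((2 : ℝ) / α)) := by
    rw [div_le_iff₀ hs0] at h1
    linarith
  calc p * (M / level p s α C₁ L ^ (α - 2)) * C₂
      = p / level p s α C₁ L ^ (α - 2) * (M * C₂) := by ring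
    _ ≤ (s * ((p : ℝ) / s) ^ ((2 : ℝ) / α)) * (M * C₂) := by
        refine mul_le_mul_of_nonneg_right ?_ (by positivity)
        rw [div_le_iff₀ h2]
        linarith
    _ = _ := by ring
end

theorem integral_ite_le_measureReal {Ω : Type*} [MeasurableSpace Ω] (μ : Measure Ω)
    [IsFiniteMeasure μ] (Q : Ω → Prop) [∀ ω, Decidable (Q ω)] (B : Set Ω) (h : ∀ ω, Q ω → ω ∈ B) :
    ∫ ω, (if Q ω then (1 : ℝ) else 0) ∂μ ≤ μ.real B := by
  have hB := measurableSet_toMeasurable μ B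
  calc ∫ ω, (if Q ω then (1 : ℝ) else 0) ∂μ
      ≤ ∫ ω, (toMeasurable μ B).indicator (fun _ => (1 : ℝ)) ω ∂μ := by
        refine integral_mono_of_nonneg (ae_of_all _ fun ω => ?_)
          ((integrable_const _).indicator hB) (ae_of_all _ fun ω => ?_)
        · dsimp only; split_ifs <;> simp
        · dsimp only
          split_ifs with hq
          · rw [Set.indicator_of_mem (subset_toMeasurable μ B (h ω hq))]
          · exact Set.indicator_nonneg (fun _ _ => zero_le_one) _
    _ = μ.real B := by
        rw [integral_indicator_const _ hB, smul_eq_mul, mul_one, measureReal_def, measureReal_def,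
          measure_toMeasurable]

theorem iSup_mem_le_of_le {ι : Type*} {S : Set ι} {f : ι → ℝ} {c : ℝ} (hc : 0 ≤ c)
    (h : ∀ i ∈ S, f i ≤ c) : ⨆ i ∈ S, f i ≤ c :=
  Real.iSup_le (fun i => Real.iSup_le (fun hi => h i hi) hc) hc

theorem exists_grid_iff {p n s : ℕ} {α C₁ C₂ : ℝ} (hn : 2 ≤ n) (hs : 1 ≤ s) (hsp : s ≤ p)
    (hC₂ : 0 < C₂) (m : ℕ → ℕ)
    (hm : ∀ k, 1 ≤ m k ∧ 1 ≤ min (2 ^ (k + 1)) (DeltaSparse n) / 2 ∧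
      min (2 ^ (k + 1)) (DeltaSparse n) / 2 * m k = 2 ^ k) (X : Fin n → Fin p → ℝ) :
    (∃ t ∈ Tgrid n,
      1 < AMoMa p n X t (min t (DeltaSparse n) / 2)
            (C₁ * (((p : ℝ) / (s : ℝ)) ^ ((1 : ℝ) / α) +
              ((s : ℝ) ^ (-(1 : ℝ) / 2)) * Real.sqrt (LL n))) /
          (C₂ * (if t = 1 then (s : ℝ) * ((p : ℝ) / (s : ℝ)) ^ ((2 : ℝ) / α)
                 else Real.sqrt (s : ℝ) * ((min t (DeltaSparse n) / 2 : ℕ) : ℝ)))) ↔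
      C₂ * (s * ((p : ℝ) / s) ^ ((2 : ℝ) / α)) <
          firstStat (level p s α C₁ (LL n)) (fun q => halfDiff p n q X) ∨
        ∃ k ∈ Finset.range (Nat.log 2 (n / 2)),
          C₂ * (√s * ((min (2 ^ (k + 1)) (DeltaSparse n) / 2 : ℕ) : ℝ)) <
          momStat (2 ^ k) (m k) (min (2 ^ (k + 1)) (DeltaSparse n) / 2)
            (level p s α C₁ (LL n)) (fun q => halfDiff p n q X) := by
  have hs0 : (0 : ℝ) < s := by exact_mod_cast hs
  have hp0 : (0 : ℝ) < p := by exact_mod_cast hs.trans hsp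
  have hgrid : ∀ k, k + 1 ≤ Nat.log 2 (n / 2) → 2 * 2 ^ k ≤ n / 2 := by
    intro k hk
    rw [← pow_succ']
    exact (Nat.pow_le_pow_right (by norm_num) hk).trans (Nat.pow_log_le_self 2 (by omega))
  have hterm : ∀ k, k + 1 ≤ Nat.log 2 (n / 2) →
      (1 < AMoMa p n X (2 ^ (k + 1)) (min (2 ^ (k + 1)) (DeltaSparse n) / 2)
            (C₁ * (((p : ℝ) / (s : ℝ)) ^ ((1 : ℝ) / α) +
              ((s : ℝ) ^ (-(1 : ℝ) / 2)) * Real.sqrt (LL n))) /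
          (C₂ * (if 2 ^ (k + 1) = 1 then (s : ℝ) * ((p : ℝ) / (s : ℝ)) ^ ((2 : ℝ) / α)
                 else Real.sqrt (s : ℝ) *
                  ((min (2 ^ (k + 1)) (DeltaSparse n) / 2 : ℕ) : ℝ))) ↔
        C₂ * (√s * ((min (2 ^ (k + 1)) (DeltaSparse n) / 2 : ℕ) : ℝ)) <
          momStat (2 ^ k) (m k) (min (2 ^ (k + 1)) (DeltaSparse n) / 2)
            (level p s α C₁ (LL n)) (fun q => halfDiff p n q X)) := by
    intro k hk
    obtain ⟨h1, h2, h3⟩ := hm k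
    have hne : 2 ^ (k + 1) ≠ 1 := by
      rw [pow_succ]; omega
    have hG0 : (0 : ℝ) < ((min (2 ^ (k + 1)) (DeltaSparse n) / 2 : ℕ) : ℝ) := by exact_mod_cast h2
    rw [if_neg hne, one_lt_div (by positivity)]
    have e := AMoMa_eq p n X h1 Nat.one_le_two_pow h3 (hgrid k hk) (level p s α C₁ (LL n))
    rw [← pow_succ'] at e
    rw [← e, level]
  have hone : (1 < AMoMa p n X 1 (min 1 (DeltaSparse n) / 2)
            (C₁ * (((p : ℝ) / (s : ℝ)) ^ ((1 : ℝ) / α) +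
              ((s : ℝ) ^ (-(1 : ℝ) / 2)) * Real.sqrt (LL n))) /
          (C₂ * (if 1 = 1 then (s : ℝ) * ((p : ℝ) / (s : ℝ)) ^ ((2 : ℝ) / α)
                 else Real.sqrt (s : ℝ) * ((min 1 (DeltaSparse n) / 2 : ℕ) : ℝ))) ↔
      C₂ * (s * ((p : ℝ) / s) ^ ((2 : ℝ) / α)) <
          firstStat (level p s α C₁ (LL n)) (fun q => halfDiff p n q X)) := by
    rw [if_pos rfl, one_lt_div (by positivity), AMoMa_one_eq p n hn, level]
  constructor
  · rintro ⟨t, ht, h⟩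
    obtain ⟨k, hk, rfl⟩ := Finset.mem_image.1 ht
    rw [Finset.mem_range] at hk
    rcases k with _ | k
    · exact Or.inl (hone.1 h)
    · exact Or.inr ⟨k, Finset.mem_range.2 (by omega), (hterm k (by omega)).1 h⟩
  · rintro (h | ⟨k, hk, h⟩)
    · exact ⟨1, Finset.mem_image.2 ⟨0, by simp, rfl⟩, hone.2 h⟩
    · rw [Finset.mem_range] at hk
      exact ⟨2 ^ (k + 1), Finset.mem_image.2 ⟨k + 1, Finset.mem_range.2 (by omega), rfl⟩,
        (hterm k hk).2 h⟩

theorem sum_scales_le {K : ℕ} {δ b x : ℝ} (hδ : 0 < δ) (hb0 : 0 < b) (hb : b ≤ 1 / 3)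
    (hx : K * x ≤ 2) :
    ∑ k ∈ Finset.range K, (2 * δ * (1 / 2) ^ k + b ^ (k + 1) + (2 * δ + b) * x) ≤
      8 * δ + 4 * b := by
  have h1 : ∑ k ∈ Finset.range K, (1 / 2 : ℝ) ^ k ≤ 2 := by
    rw [geom_sum_eq (by norm_num)]
    have : (0 : ℝ) ≤ (1 / 2) ^ K := by positivity
    rw [div_le_iff_of_neg (by norm_num)]
    linarith
  have h2 : ∑ k ∈ Finset.range K, b ^ k ≤ 2 := by
    refine le_trans (Finset.sum_le_sum fun k _ => ?_) h1
    exact pow_le_pow_left₀ hb0.le (by linarith) k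
  rw [Finset.sum_add_distrib, Finset.sum_add_distrib, ← Finset.mul_sum, Finset.sum_const,
    Finset.card_range, nsmul_eq_mul]
  simp_rw [pow_succ b, ← Finset.sum_mul]
  nlinarith [mul_le_mul_of_nonneg_right h2 hb0.le]

theorem type_one_error_le {p n s : ℕ} {α K δ b C₁ C₂ : ℝ} (hα : 4 ≤ α) (hK : 0 < K) (hn : 2 ≤ n)
    (hs1 : 1 ≤ s) (hsp : s ≤ p) (hδ : 0 < δ) (hδ1 : 2 * δ ≤ 1) (hb0 : 0 < b) (hb : b ≤ 1 / 3)
    (hC₁ : 1 ≤ C₁)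
    (hC : ∀ (p s N : ℕ) (L : ℝ), 1 ≤ s → s ≤ p → 1 ≤ N → 0 ≤ L →
      Real.exp 1 * ((p : ℝ) / s) * tailBound α (2 ^ α * (K ^ α + K ^ α)) N (level p s α C₁ L) ≤
        δ / N + δ * Real.exp (-(L / s)))
    (hC₂ : 2 * √(4 + 2 ^ α * (K ^ α + K ^ α)) / b ≤ C₂)
    {P : Measure (Fin n → Fin p → ℝ)} (hP : P ∈ Pclass p n α K) {θ : Fin n → Fin p → ℝ}
    (hθ : θ ∈ Theta0 p n) :
    ∫ E, phiPsparseMoM p n s α C₁ C₂ (θ + E) ∂P ≤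
      2 ^ α * (K ^ α + K ^ α) / C₂ + (8 * δ + 4 * b) := by
  set M := 2 ^ α * (K ^ α + K ^ α) with hM_def
  have hM : 0 < M := by positivity
  have hC20 : 0 < C₂ := lt_of_lt_of_le (by positivity) hC₂
  have hi := iIndepFun_halfDiff hP
  have hprob : IsProbabilityMeasure P := hi.isProbabilityMeasure
  have hst : ∀ i < n / 2, ∀ j, Standardized P (halfDiff p n (i, j)) α M :=
    fun i h j => standardized_halfDiff (by linarith) hK hP h j
  have hL := one_le_LL hn
  choose m hm1 hG hGm _ hGL using exists_group_eq hn
  have hx : ∀ E, (fun q => halfDiff p n q (θ + E)) = fun q => halfDiff p n q E := by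
    intro E; funext q
    rw [halfDiff_add, halfDiff_of_mem_Theta0 hθ, zero_add]
  have hgrid : ∀ k ∈ Finset.range (Nat.log 2 (n / 2)), 2 * 2 ^ k ≤ n / 2 := by
    intro k hk
    rw [← pow_succ']
    exact (Nat.pow_le_pow_right (by norm_num) (Finset.mem_range.1 hk)).trans
      (Nat.pow_log_le_self 2 (by omega))
  unfold phiPsparseMoM
  refine (integral_ite_le_measureReal P _
    ({E | C₂ * (s * ((p : ℝ) / s) ^ ((2 : ℝ) / α)) <
          firstStat (level p s α C₁ (LL n)) (fun q => halfDiff p n q E)} ∪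
      ⋃ k ∈ Finset.range (Nat.log 2 (n / 2)),
        {E | C₂ * (√s * ((min (2 ^ (k + 1)) (DeltaSparse n) / 2 : ℕ) : ℝ)) <
          momStat (2 ^ k) (m k) (min (2 ^ (k + 1)) (DeltaSparse n) / 2)
            (level p s α C₁ (LL n)) (fun q => halfDiff p n q E)}) fun E hE => ?_).trans ?_
  · have := (exists_grid_iff hn hs1 hsp hC20 m (fun k => ⟨hm1 k, hG k, hGm k⟩) (θ + E)).1 hE
    simp only [hx] at this
    rcases this with h | ⟨k, hk, h⟩
    · exact Or.inl h
    · exact Or.inr (Set.mem_iUnion₂.2 ⟨k, hk, h⟩)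
  · refine (measureReal_union_le _ _).trans (add_le_add ?_ ?_)
    · exact measureReal_lt_firstStat_le hα hM (hst 0 (by omega)) hs1 hsp hC₁ hC20
    · refine (measureReal_biUnion_finset_le _ _).trans ((Finset.sum_le_sum fun k hk => ?_).trans
        (sum_scales_le hδ hb0 hb (natLog_mul_exp_neg_LL_le hn)))
      exact measureReal_lt_momStat_le hα hM (measurable_halfDiff p n) hi hst (hm1 k) (hG k)
        (hGm k) (hgrid k hk) hs1 hsp hL (hGL k) hδ hδ1 hb0 hb (by linarith)
        (hC p s (2 ^ k) (LL n) hs1 hsp Nat.one_le_two_pow (by linarith)) hC₂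

theorem sq_div_two_sub_sq_le (x y : ℝ) : x ^ 2 / 4 - y ^ 2 ≤ (x / √2 + y) ^ 2 := by
  have h2 : (x / √2) ^ 2 = x ^ 2 / 2 := by rw [div_pow, Real.sq_sqrt (by norm_num)]
  nlinarith [sq_nonneg (x / √2 + 2 * y)]

theorem le_of_momStat_le {p N m G : ℕ} {a c : ℝ} {x : ℕ × Fin p → ℝ} {d η : Fin p → ℝ}
    {w : ℕ → Fin p → ℝ} {S : Finset (Fin p)} (hm : 1 ≤ m) (hG : 1 ≤ G) (hGm : G * m = N)
    (hd : ∀ j ∉ S, d j = 0)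
    (hodd : ∀ j, oddSum N x j = √N * (d j / √2) + η j)
    (heven : ∀ g < G, ∀ j, evenMean m g x j = d j / √2 + w g j)
    (h : momStat N m G a x ≤ c * G) :
    N / 4 * ∑ j, d j ^ 2 ≤ S.card * a ^ 2 + ∑ j ∈ S, η j ^ 2 +
      G * (c + S.card + ∑ j, (if a ≤ |η j| then (1 : ℝ) else 0)) +
      2 * m * ∑ g ∈ Finset.range G, ∑ j ∈ S, w g j ^ 2 := by
  have hm0 : (0 : ℝ) < m := by exact_mod_cast hm
  have hG0 : (0 : ℝ) < G := by exact_mod_cast hG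
  have hN : (N : ℝ) = G * m := by rw [← hGm]; push_cast; ring
  have hN0 : (0 : ℝ) < N := by rw [hN]; positivity
  set B : Fin p → ℝ := fun j => if a ≤ |oddSum N x j| then 1 else 0 with hB
  have hB0 : ∀ j, 0 ≤ B j := fun j => by simp only [hB]; split_ifs <;> norm_num
  have hB1 : ∀ j, B j ≤ 1 := fun j => by simp only [hB]; split_ifs <;> norm_num
  set n₀ := ∑ j, (if a ≤ |η j| then (1 : ℝ) else 0) with hn₀
  set D := ∑ j ∈ S, d j ^ 2 * B j with hD
  have hdS : ∑ j, d j ^ 2 = ∑ j ∈ S, d j ^ 2 := by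
    symm
    refine Finset.sum_subset (Finset.subset_univ _) fun j _ hj => ?_
    rw [hd j hj]; norm_num
  have hDge : N / 4 * ∑ j, d j ^ 2 ≤ N / 4 * D + S.card * a ^ 2 + ∑ j ∈ S, η j ^ 2 := by
    rw [hdS, hD, Finset.mul_sum, Finset.mul_sum, ← nsmul_eq_mul, ← Finset.sum_const,
      ← Finset.sum_add_distrib, ← Finset.sum_add_distrib]
    refine Finset.sum_le_sum fun j _ => ?_
    by_cases hj : a ≤ |oddSum N x j|
    · have : B j = 1 := by simp [hB, hj]
      rw [this]
      nlinarith [sq_nonneg a, sq_nonneg (η j)]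
    · have : B j = 0 := by simp [hB, hj]
      rw [this]
      push Not at hj
      have h1 := sq_lt_sq' (by linarith [abs_nonneg (oddSum N x j), neg_abs_le (oddSum N x j)])
        (lt_of_le_of_lt (le_abs_self _) hj)
      rw [hodd] at h1
      have h2 := sq_div_two_sub_sq_le (√N * d j) (η j)
      rw [mul_pow, Real.sq_sqrt hN0.le, mul_div_assoc √(N : ℝ)] at h2
      nlinarith [sq_nonneg a, sq_nonneg (η j)]
  have hblock : ∀ g < G, D / 4 - ∑ j ∈ S, w g j ^ 2 - S.card * (1 / m) - n₀ * (1 / m) ≤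
      ∑ j, (evenMean m g x j ^ 2 - 1 / m) * B j := by
    intro g hg
    have hm1 : (0 : ℝ) < 1 / m := by positivity
    rw [← Finset.sum_add_sum_compl S]
    have h1 : D / 4 - ∑ j ∈ S, w g j ^ 2 - S.card * (1 / m) ≤
        ∑ j ∈ S, (evenMean m g x j ^ 2 - 1 / m) * B j := by
      rw [hD, Finset.sum_div, ← nsmul_eq_mul, ← Finset.sum_const, ← Finset.sum_sub_distrib,
        ← Finset.sum_sub_distrib]
      refine Finset.sum_le_sum fun j _ => ?_
      have h3 := mul_le_mul_of_nonneg_right (sq_div_two_sub_sq_le (d j) (w g j)) (hB0 j)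
      rw [heven g hg]
      nlinarith [mul_le_mul_of_nonneg_left (hB1 j) (sq_nonneg (w g j)),
        mul_le_mul_of_nonneg_left (hB1 j) hm1.le]
    have h2 : -(n₀ * (1 / m)) ≤ ∑ j ∈ Sᶜ, (evenMean m g x j ^ 2 - 1 / m) * B j := by
      have h3 : ∑ j ∈ Sᶜ, -((if a ≤ |η j| then (1 : ℝ) else 0) * (1 / m)) ≤
          ∑ j ∈ Sᶜ, (evenMean m g x j ^ 2 - 1 / m) * B j := by
        refine Finset.sum_le_sum fun j hj => ?_
        have : B j = if a ≤ |η j| then (1 : ℝ) else 0 := by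
          simp only [hB]
          rw [hodd, hd j (Finset.mem_compl.1 hj), zero_div, mul_zero, zero_add]
        rw [← this]
        nlinarith [mul_nonneg (sq_nonneg (evenMean m g x j)) (hB0 j)]
      refine le_trans ?_ h3
      rw [Finset.sum_neg_distrib, ← Finset.sum_mul]
      refine neg_le_neg (mul_le_mul_of_nonneg_right ?_ hm1.le)
      exact Finset.sum_le_sum_of_subset_of_nonneg (Finset.subset_univ _)
        fun j _ _ => by split_ifs <;> norm_num
    linarith
  have hmed : median (List.ofFn fun g : Fin G =>
      ∑ j, (evenMean m g x j ^ 2 - 1 / m) * B j) ≤ c / m := by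
    rw [le_div_iff₀ hm0]
    have : (N : ℝ) * median (List.ofFn fun g : Fin G =>
      ∑ j, (evenMean m g x j ^ 2 - 1 / m) * B j) ≤ c * G := h
    rw [hN] at this
    refine le_of_mul_le_mul_left ?_ hG0
    linarith
  have hcard := card_le_of_median_le hG _ _ hmed
  set A := Finset.univ.filter fun g : Fin G =>
    ∑ j, (evenMean m g x j ^ 2 - 1 / m) * B j ≤ c / m with hA
  have hcardr : (G : ℝ) ≤ 2 * A.card := by exact_mod_cast hcard
  have hA0 : (0 : ℝ) < A.card := by linarith
  set V := ∑ g ∈ Finset.range G, ∑ j ∈ S, w g j ^ 2 with hV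
  have hV0 : 0 ≤ V := Finset.sum_nonneg fun g _ => Finset.sum_nonneg fun j _ => sq_nonneg _
  have hsum : A.card * (D / 4 - S.card * (1 / m) - n₀ * (1 / m) - c / m) ≤ V := by
    have h1 : ∑ g ∈ A, ∑ j ∈ S, w g j ^ 2 ≤ V := by
      rw [hV, ← Fin.sum_univ_eq_sum_range (fun g => ∑ j ∈ S, w g j ^ 2) G]
      exact Finset.sum_le_sum_of_subset_of_nonneg (Finset.subset_univ _)
        fun g _ _ => Finset.sum_nonneg fun j _ => sq_nonneg _
    refine le_trans ?_ h1
    rw [← nsmul_eq_mul, ← Finset.sum_const]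
    refine Finset.sum_le_sum fun g hg => ?_
    have h2 := (Finset.mem_filter.1 hg).2
    have h3 := hblock g g.2
    linarith
  have hfin : G * (D / 4 - S.card * (1 / m) - n₀ * (1 / m) - c / m) ≤ 2 * V := by
    rcases le_total 0 (D / 4 - S.card * (1 / m) - n₀ * (1 / m) - c / m) with h0 | h0
    · nlinarith [mul_le_mul_of_nonneg_right hcardr h0]
    · nlinarith
  have hfin2 := mul_le_mul_of_nonneg_left hfin hm0.le
  have e : m * (G * (D / 4 - S.card * (1 / m) - n₀ * (1 / m) - c / m)) =
      N / 4 * D - G * (c + S.card + n₀) := by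
    rw [hN]; field_simp; ring
  rw [e] at hfin2
  linarith

theorem le_of_firstStat_le {p : ℕ} {a c : ℝ} {x : ℕ × Fin p → ℝ} {d η : Fin p → ℝ}
    {S : Finset (Fin p)} (ha : 1 ≤ a) (hd : ∀ j ∉ S, d j = 0)
    (hx : ∀ j, x (0, j) = d j / √2 + η j) (h : firstStat a x ≤ c) :
    (∑ j, d j ^ 2) / 4 ≤ S.card * a ^ 2 + ∑ j ∈ S, η j ^ 2 + c := by
  have hdS : ∑ j, d j ^ 2 = ∑ j ∈ S, d j ^ 2 := by
    symm
    refine Finset.sum_subset (Finset.subset_univ _) fun j _ hj => ?_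
    rw [hd j hj]; norm_num
  have hterm : ∀ j, max 0 (x (0, j) ^ 2 - a ^ 2) ≤
      (x (0, j) ^ 2 - 1) * (if a ≤ |x (0, j)| then 1 else 0) := by
    intro j
    have hs := sq_abs (x (0, j))
    split_ifs with hj
    · rw [mul_one]
      exact max_le (by nlinarith) (by nlinarith)
    · push Not at hj
      rw [mul_zero]
      exact max_le le_rfl (by nlinarith [abs_nonneg (x (0, j))])
  have h1 : ∑ j ∈ S, (x (0, j) ^ 2 - a ^ 2) ≤ c := by
    refine le_trans ?_ h
    rw [firstStat]
    refine (Finset.sum_le_sum fun j _ => (le_max_right _ _).trans (hterm j)).trans ?_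
    exact Finset.sum_le_sum_of_subset_of_nonneg (Finset.subset_univ _)
      fun j _ _ => (le_max_left _ _).trans (hterm j)
  rw [Finset.sum_sub_distrib, Finset.sum_const, nsmul_eq_mul] at h1
  have h2 : ∑ j ∈ S, (d j ^ 2 / 4 - η j ^ 2) ≤ ∑ j ∈ S, x (0, j) ^ 2 :=
    Finset.sum_le_sum fun j _ => by rw [hx]; exact sq_div_two_sub_sq_le _ _
  rw [Finset.sum_sub_distrib, ← Finset.sum_div] at h2
  rw [hdS]
  linarith

section
variable {Ω : Type*} [MeasurableSpace Ω] {μ : Measure Ω} {p : ℕ} {W : ℕ × Fin p → Ω → ℝ}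
  {h : ℕ} {α M : ℝ}

theorem measureReal_mul_lt_le {f : Ω → ℝ} {L c : ℝ} (hf0 : ∀ ω, 0 ≤ f ω) (hf : Integrable f μ)
    [IsFiniteMeasure μ] (hL : 0 < L) (hc : 0 < c) (hfc : ∫ ω, f ω ∂μ ≤ c) :
    μ.real {ω | L * c < f ω} ≤ 1 / L := by
  have h1 := mul_meas_ge_le_integral_of_nonneg (ae_of_all _ hf0) hf (L * c)
  have h2 : μ.real {ω | L * c < f ω} ≤ μ.real {ω | L * c ≤ f ω} :=
    measureReal_mono (fun ω hω => le_of_lt (Set.mem_ofPred_eq ▸ hω)) (measure_ne_top _ _)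
  refine h2.trans ?_
  rw [le_div_iff₀ hL]
  refine le_of_mul_le_mul_left ?_ hc
  linarith

theorem integral_sum_oddSum_sq (hα : 4 ≤ α) (hm : ∀ q, Measurable (W q))
    (hi : ProbabilityTheory.iIndepFun W μ) (hs : ∀ i < h, ∀ j, Standardized μ (W (i, j)) α M)
    {N : ℕ} (hN : 1 ≤ N) (hNh : 2 * N ≤ h) (S : Finset (Fin p)) :
    Integrable (fun ω => ∑ j ∈ S, oddSum N (fun q => W q ω) j ^ 2) μ ∧
      ∫ ω, ∑ j ∈ S, oddSum N (fun q => W q ω) j ^ 2 ∂μ = S.card := by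
  have H := fun j => integral_oddSum_sq hα hm hi hs hN hNh j
  refine ⟨integrable_finsetSum _ fun j _ => (H j).1, ?_⟩
  rw [integral_finsetSum _ fun j _ => (H j).1]
  simp [(H _).2]

theorem integral_sum_evenMean_sq (hα : 4 ≤ α) (hM : 0 < M) (hm : ∀ q, Measurable (W q))
    (hi : ProbabilityTheory.iIndepFun W μ) (hs : ∀ i < h, ∀ j, Standardized μ (W (i, j)) α M)
    {m G : ℕ} (hm1 : 1 ≤ m) (hGh : 2 * (G * m) ≤ h) (S : Finset (Fin p)) :
    Integrable (fun ω => ∑ g ∈ Finset.range G, ∑ j ∈ S, evenMean m g (fun q => W q ω) j ^ 2) μ ∧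
      ∫ ω, ∑ g ∈ Finset.range G, ∑ j ∈ S, evenMean m g (fun q => W q ω) j ^ 2 ∂μ =
        G * (S.card * (1 / m)) := by
  have H : ∀ g ∈ Finset.range G, ∀ j, Integrable (fun ω => evenMean m g (fun q => W q ω) j ^ 2) μ ∧
      ∫ ω, evenMean m g (fun q => W q ω) j ^ 2 ∂μ = 1 / m := by
    intro g hg j
    have hg' := Nat.mul_le_mul_right m (Nat.succ_le_of_lt (Finset.mem_range.1 hg))
    have := evenMean_moments hα hM hm hi hs hm1 (g := g)
      ((Nat.mul_le_mul_left 2 hg').trans hGh) j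
    exact ⟨this.1, this.2.2.1⟩
  have H2 : ∀ g ∈ Finset.range G,
      Integrable (fun ω => ∑ j ∈ S, evenMean m g (fun q => W q ω) j ^ 2) μ :=
    fun g hg => integrable_finsetSum _ fun j _ => (H g hg j).1
  refine ⟨integrable_finsetSum _ H2, ?_⟩
  rw [integral_finsetSum _ H2]
  calc _ = ∑ g ∈ Finset.range G, (S.card * (1 / m) : ℝ) := by
        refine Finset.sum_congr rfl fun g hg => ?_
        rw [integral_finsetSum _ fun j _ => (H g hg j).1, Finset.sum_congr rfl fun j _ => (H g hg j).2]
        simp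
    _ = _ := by simp

theorem integral_sum_oddSum_ge_le (hα : 4 ≤ α) (hM : 0 < M) (hm : ∀ q, Measurable (W q))
    (hi : ProbabilityTheory.iIndepFun W μ) (hs : ∀ i < h, ∀ j, Standardized μ (W (i, j)) α M)
    {N : ℕ} (hN : 1 ≤ N) (hNh : 2 * N ≤ h) {a : ℝ} (ha : 0 < a) :
    Integrable (fun ω => ∑ j, (if a ≤ |oddSum N (fun q => W q ω) j| then (1 : ℝ) else 0)) μ ∧
      ∫ ω, ∑ j, (if a ≤ |oddSum N (fun q => W q ω) j| then (1 : ℝ) else 0) ∂μ ≤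
        p * tailBound α M N a := by
  have hprob : IsProbabilityMeasure μ := hi.isProbabilityMeasure
  have hmeas : ∀ j, Measurable fun ω => |oddSum N (fun q => W q ω) j| := fun j =>
    ((measurable_oddSum N j).comp (measurable_pi_lambda _ hm)).abs
  have h_int : ∀ j : Fin p, Integrable
      (fun ω => if a ≤ |oddSum N (fun q => W q ω) j| then (1 : ℝ) else 0) μ := by
    intro j
    refine Integrable.of_bound (C := 1) (Measurable.ite
      (measurableSet_le measurable_const (hmeas j)) measurable_const
      measurable_const).aestronglyMeasurable (ae_of_all _ fun ω => ?_)
    split_ifs <;> simp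
  refine ⟨integrable_finsetSum _ fun j _ => h_int j, ?_⟩
  rw [integral_finsetSum _ fun j _ => h_int j]
  refine (Finset.sum_le_sum fun j _ => (integral_ite_le_measureReal μ _
    {ω | a ≤ |oddSum N (fun q => W q ω) j|} fun ω hω => hω).trans
      (measureReal_le_oddSum_le hα hM hm hi hs hN hNh ha j)).trans ?_
  simp [tailBound, mul_add]
end

theorem oddSum_add_of_eq {p N : ℕ} {u x : ℕ × Fin p → ℝ} {d : Fin p → ℝ} (hN : 1 ≤ N)
    (hu : ∀ i < 2 * N, ∀ j, u (i, j) = d j / √2) (j : Fin p) :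
    oddSum N (fun q => u q + x q) j = √N * (d j / √2) + oddSum N x j := by
  have hN0 : (0 : ℝ) < √N := Real.sqrt_pos.2 (by exact_mod_cast hN)
  have hs : √(N : ℝ) * √N = N := Real.mul_self_sqrt (Nat.cast_nonneg N)
  have h : ∑ i ∈ Finset.range N, u (2 * i + 1, j) = N * (d j / √2) := by
    rw [Finset.sum_congr rfl fun i hi => hu (2 * i + 1)
      (by have := Finset.mem_range.1 hi; omega) j]
    simp
  simp only [oddSum]
  rw [Finset.sum_add_distrib, h, add_div]
  congr 1
  rw [div_eq_iff hN0.ne']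
  linear_combination (-(d j / √2)) * hs

theorem evenMean_add_of_eq {p N m G g : ℕ} {u x : ℕ × Fin p → ℝ} {d : Fin p → ℝ} (hm : 1 ≤ m)
    (hGm : G * m = N) (hg : g < G) (hu : ∀ i < 2 * N, ∀ j, u (i, j) = d j / √2) (j : Fin p) :
    evenMean m g (fun q => u q + x q) j = d j / √2 + evenMean m g x j := by
  have hm0 : (0 : ℝ) < m := by exact_mod_cast hm
  have h : ∑ i ∈ Finset.range m, u (2 * (g * m + i), j) = m * (d j / √2) := by
    rw [Finset.sum_congr rfl fun i hi => hu (2 * (g * m + i)) (by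
      have hi' := Finset.mem_range.1 hi
      have := Nat.mul_le_mul_right m (Nat.succ_le_of_lt hg)
      rw [Nat.succ_mul] at this
      omega) j]
    simp
  simp only [evenMean]
  rw [Finset.sum_add_distrib, h, add_div]
  congr 1
  field_simp

section
variable {Ω : Type*} [MeasurableSpace Ω] {μ : Measure Ω} {p : ℕ} {W : ℕ × Fin p → Ω → ℝ}
  {h : ℕ} {α M : ℝ}

theorem measureReal_momStat_le_le (hα : 4 ≤ α) (hM : 0 < M) (hm : ∀ q, Measurable (W q))
    (hi : ProbabilityTheory.iIndepFun W μ) (hs : ∀ i < h, ∀ j, Standardized μ (W (i, j)) α M)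
    {N m G s : ℕ} {a c L : ℝ} {u : ℕ × Fin p → ℝ} {d : Fin p → ℝ}
    (hm1 : 1 ≤ m) (hG : 1 ≤ G) (hGm : G * m = N) (hNh : 2 * N ≤ h) (hs1 : 1 ≤ s)
    (ha : 0 < a) (hL : 0 < L) (hu : ∀ i < 2 * N, ∀ j, u (i, j) = d j / √2) (hd : l0 p d ≤ s)
    (htb : p * tailBound α M N a ≤ s)
    (hsig : s * a ^ 2 + L * s + G * (c + s + 3 * L * s) < N / 4 * ∑ j, d j ^ 2) :
    μ.real {ω | momStat N m G a (fun q => u q + W q ω) ≤ c * G} ≤ 3 / L := by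
  have hprob : IsProbabilityMeasure μ := hi.isProbabilityMeasure
  have hs0 : (0 : ℝ) < s := by exact_mod_cast hs1
  have hm0 : (0 : ℝ) < m := by exact_mod_cast hm1
  have hG0 : (0 : ℝ) < G := by exact_mod_cast hG
  have hN1 : 1 ≤ N := by rw [← hGm]; exact Nat.mul_pos hG hm1
  set S := Finset.univ.filter fun j : Fin p => d j ≠ 0 with hS
  have hcard : (S.card : ℝ) ≤ s := by exact_mod_cast hd
  have hdS : ∀ j ∉ S, d j = 0 := fun j hj => by simpa [hS] using hj
  obtain ⟨i1, e1⟩ := integral_sum_oddSum_sq hα hm hi hs hN1 hNh S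
  obtain ⟨i2, e2⟩ := integral_sum_evenMean_sq hα hM hm hi hs hm1
    (G := G) (by rw [hGm]; exact hNh) S
  obtain ⟨i3, e3⟩ := integral_sum_oddSum_ge_le hα hM hm hi hs hN1 hNh ha
  have b1 := measureReal_mul_lt_le (fun ω => Finset.sum_nonneg fun j _ => sq_nonneg _) i1 hL hs0
    (e1.trans_le hcard)
  have b2 := measureReal_mul_lt_le
    (fun ω => Finset.sum_nonneg fun g _ => Finset.sum_nonneg fun j _ => sq_nonneg _) i2 hL
    (c := G * (s * (1 / m))) (by positivity) (e2.trans_le (by gcongr))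
  have b3 := measureReal_mul_lt_le
    (fun ω => Finset.sum_nonneg fun j _ => by split_ifs <;> norm_num) i3 hL hs0 (e3.trans htb)
  have hsum : 3 / L = 1 / L + (1 / L + 1 / L) := by ring
  rw [hsum]
  refine le_trans (measureReal_mono (fun ω hω => ?_) (measure_ne_top _ _))
    ((measureReal_union_le _ _).trans (add_le_add b1
      ((measureReal_union_le _ _).trans (add_le_add b2 b3))))
  by_contra hbad
  simp only [Set.mem_union, Set.mem_ofPred_eq, not_or, not_lt] at hbad
  obtain ⟨h1, h2, h3⟩ := hbad
  rw [Set.mem_ofPred_eq] at hω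
  have key := le_of_momStat_le hm1 hG hGm hdS (fun j => oddSum_add_of_eq hN1 hu j)
    (fun g hg j => evenMean_add_of_eq hm1 hGm hg hu j) hω
  have h4 : 2 * (m : ℝ) * (L * (G * (s * (1 / m)))) = G * (2 * L * s) := by field_simp
  have h5 := mul_le_mul_of_nonneg_left h2 (by positivity : (0 : ℝ) ≤ 2 * m)
  rw [h4] at h5
  have h6 := mul_le_mul_of_nonneg_right hcard (sq_nonneg a)
  have h7 := mul_le_mul_of_nonneg_left (add_le_add hcard h3) hG0.le
  linarith

theorem measureReal_firstStat_le_le (hα : 4 ≤ α) [IsProbabilityMeasure μ]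
    (hs : ∀ j, Standardized μ (W (0, j)) α M) {s : ℕ} {a c L : ℝ} {u : ℕ × Fin p → ℝ}
    {d : Fin p → ℝ} (hs1 : 1 ≤ s) (ha : 1 ≤ a) (hL : 0 < L) (hu : ∀ j, u (0, j) = d j / √2)
    (hd : l0 p d ≤ s) (hsig : s * a ^ 2 + L * s + c < (∑ j, d j ^ 2) / 4) :
    μ.real {ω | firstStat a (fun q => u q + W q ω) ≤ c} ≤ 1 / L := by
  have hs0 : (0 : ℝ) < s := by exact_mod_cast hs1
  set S := Finset.univ.filter fun j : Fin p => d j ≠ 0 with hS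
  have hcard : (S.card : ℝ) ≤ s := by exact_mod_cast hd
  have hdS : ∀ j ∉ S, d j = 0 := fun j hj => by simpa [hS] using hj
  have h_int : ∀ j, Integrable (fun ω => W (0, j) ω ^ 2) μ := fun j =>
    (hs j).integrable_pow 2 (by push_cast; linarith)
  have e : ∫ ω, ∑ j ∈ S, W (0, j) ω ^ 2 ∂μ ≤ s := by
    rw [integral_finsetSum _ fun j _ => h_int j, Finset.sum_congr rfl fun j _ => (hs j).sq]
    simpa using hcard
  refine le_trans (measureReal_mono (fun ω hω => ?_) (measure_ne_top _ _))
    (measureReal_mul_lt_le (fun ω => Finset.sum_nonneg fun j _ => sq_nonneg _)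
      (integrable_finsetSum S fun j _ => h_int j) hL hs0 e)
  by_contra hbad
  rw [Set.mem_ofPred_eq, not_lt] at hbad
  rw [Set.mem_ofPred_eq] at hω
  have key := le_of_firstStat_le ha hdS (fun j => by rw [hu]) hω
  have h6 := mul_le_mul_of_nonneg_right hcard (sq_nonneg a)
  linarith
end

theorem exists_scale {n t0 : ℕ} (h1 : 1 ≤ t0) (h2 : t0 ≤ n - 1) :
    ∃ k ≤ Nat.log 2 (n / 2), 2 ^ k ≤ t0 ∧ 2 ^ k ≤ n - t0 ∧
      (t0 : ℝ) * ((n : ℝ) - t0) / n ≤ 2 * 2 ^ k := by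
  refine ⟨Nat.log 2 (min t0 (n - t0)), Nat.log_mono_right (by omega), ?_, ?_, ?_⟩
  · exact (Nat.pow_log_le_self 2 (by omega)).trans (min_le_left _ _)
  · exact (Nat.pow_log_le_self 2 (by omega)).trans (min_le_right _ _)
  · have h3 := Nat.lt_pow_succ_log_self (b := 2) (by norm_num) (min t0 (n - t0))
    set k := Nat.log 2 (min t0 (n - t0))
    rw [Nat.succ_eq_add_one, pow_succ'] at h3
    have h4 : ((min t0 (n - t0) : ℕ) : ℝ) ≤ 2 * 2 ^ k := by exact_mod_cast h3.le
    refine le_trans ?_ h4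
    have hn0 : (0 : ℝ) < n := by exact_mod_cast (by omega : 0 < n)
    have ht : (t0 : ℝ) ≤ n := by exact_mod_cast (by omega : t0 ≤ n)
    have ht0 : (0 : ℝ) ≤ t0 := Nat.cast_nonneg _
    rw [Nat.cast_min, Nat.cast_sub (by omega)]
    refine le_min ?_ ?_
    · rw [div_le_iff₀ hn0]; nlinarith
    · rw [div_le_iff₀ hn0]; nlinarith

theorem phiPsparseMoM_eq_zero_or_one (p n s : ℕ) (α C₁ C₂ : ℝ) (X : Fin n → Fin p → ℝ) :
    phiPsparseMoM p n s α C₁ C₂ X = 0 ∨ phiPsparseMoM p n s α C₁ C₂ X = 1 :=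
  (ite_eq_or_eq _ _ _).symm

theorem mul_tailBound_le {p s N : ℕ} {α M a δ L : ℝ} (hs : 1 ≤ s) (hN : 1 ≤ N) (hM : 0 < M)
    (ha : 0 < a) (hL : 0 ≤ L) (hδ1 : 2 * δ ≤ 1) (hδ : 0 < δ)
    (h : Real.exp 1 * ((p : ℝ) / s) * tailBound α M N a ≤ δ / N + δ * Real.exp (-(L / s))) :
    p * tailBound α M N a ≤ s := by
  have hs0 : (0 : ℝ) < s := by exact_mod_cast hs
  have h2 : δ / (N : ℝ) ≤ δ := div_le_self hδ.le (by exact_mod_cast hN)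
  have h3 : δ * Real.exp (-(L / s)) ≤ δ :=
    mul_le_of_le_one_right hδ.le (Real.exp_le_one_iff.2 (by rw [neg_nonpos]; positivity))
  have htb : 0 ≤ tailBound α M N a := by unfold tailBound; positivity
  have h5 : 0 ≤ (p : ℝ) / s * tailBound α M N a := by positivity
  have h4 : (p : ℝ) / s * tailBound α M N a ≤ 1 := by
    nlinarith [Real.add_one_le_exp 1]
  calc p * tailBound α M N a = s * ((p : ℝ) / s * tailBound α M N a) := by field_simp
    _ ≤ s := mul_le_of_le_one_right hs0.le h4

theorem one_le_level {p s : ℕ} {α C L : ℝ} (hs : 1 ≤ s) (hsp : s ≤ p) (hα : 0 ≤ α) (hC : 1 ≤ C) :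
    1 ≤ level p s α C L := by
  have h1 := one_le_div_rpow hs hsp (β := 1 / α) (by positivity)
  have h2 : C * ((p : ℝ) / s) ^ ((1 : ℝ) / α) ≤ level p s α C L := le_level (by linarith)
  nlinarith

theorem mul_level_sq_le {p s : ℕ} {α C L : ℝ} (hs : 1 ≤ s) (hL : 0 ≤ L) :
    s * level p s α C L ^ 2 ≤ 2 * C ^ 2 * (s * (((p : ℝ) / s) ^ ((2 : ℝ) / α) + L)) := by
  have hs0 : (1 : ℝ) ≤ s := by exact_mod_cast hs
  have h2 : L / s ≤ L := div_le_self hL hs0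
  have h3 : level p s α C L ^ 2 ≤ 2 * C ^ 2 * (((p : ℝ) / s) ^ ((2 : ℝ) / α) + L) :=
    (level_sq_le hs hL).trans (mul_le_mul_of_nonneg_left (by linarith) (by positivity))
  calc s * level p s α C L ^ 2
      ≤ s * (2 * C ^ 2 * (((p : ℝ) / s) ^ ((2 : ℝ) / α) + L)) := by gcongr
    _ = _ := by ring

theorem type_two_error_le {p n s : ℕ} {α K δ C₁ C₂ C₃ L₀ ρ : ℝ} (hα : 4 ≤ α) (hK : 0 < K)
    (hn : 2 ≤ n) (hs1 : 1 ≤ s) (hsp : s ≤ p) (hδ1 : 2 * δ ≤ 1) (hδ : 0 < δ) (hC₁ : 1 ≤ C₁)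
    (hC : ∀ (p s N : ℕ) (L : ℝ), 1 ≤ s → s ≤ p → 1 ≤ N → 0 ≤ L →
      Real.exp 1 * ((p : ℝ) / s) * tailBound α (2 ^ α * (K ^ α + K ^ α)) N (level p s α C₁ L) ≤
        δ / N + δ * Real.exp (-(L / s)))
    (hC₂ : 0 < C₂) (hL₀ : 0 < L₀)
    (hC₃ : 16 * (2 * C₁ ^ 2 + L₀ + 16 * (C₂ + 1 + 3 * L₀)) < C₃)
    (hρ : C₃ * (s : ℝ) * (((p : ℝ) / (s : ℝ)) ^ ((2 : ℝ) / α) + LL n) ≤ ρ ^ 2)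
    {P : Measure (Fin n → Fin p → ℝ)} (hP : P ∈ Pclass p n α K) {θ : Fin n → Fin p → ℝ}
    (hθ : θ ∈ Theta1 p n s ρ) :
    ∫ E, (1 - phiPsparseMoM p n s α C₁ C₂ (θ + E)) ∂P ≤ 3 / L₀ := by
  set M := 2 ^ α * (K ^ α + K ^ α) with hM_def
  have hM : 0 < M := by positivity
  have hi := iIndepFun_halfDiff hP
  have hprob : IsProbabilityMeasure P := hi.isProbabilityMeasure
  have hst : ∀ i < n / 2, ∀ j, Standardized P (halfDiff p n (i, j)) α M :=
    fun i h j => standardized_halfDiff (by linarith) hK hP h j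
  have hL := one_le_LL hn
  have hs0 : (1 : ℝ) ≤ s := by exact_mod_cast hs1
  have hss : √(s : ℝ) ≤ s := (Real.sqrt_le_left (by linarith)).2 (by nlinarith)
  have hp0 : (0 : ℝ) < p := by exact_mod_cast hs1.trans hsp
  choose m hm1 hG hGm hGle _ using exists_group_eq hn
  set a := level p s α C₁ (LL n) with ha_def
  set R := ((p : ℝ) / s) ^ ((2 : ℝ) / α) with hR_def
  have hR : 1 ≤ R := one_le_div_rpow hs1 hsp (by positivity)
  have ha : 1 ≤ a := one_le_level hs1 hsp (by linarith) hC₁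
  have hasq : s * a ^ 2 ≤ 2 * C₁ ^ 2 * (s * (R + LL n)) := mul_level_sq_le hs1 (by linarith)
  have hsR : 0 < s * (R + LL n) := by nlinarith
  have hbig : 16 * ((2 * C₁ ^ 2 + L₀ + 16 * (C₂ + 1 + 3 * L₀)) * (s * (R + LL n))) < ρ ^ 2 := by
    refine lt_of_lt_of_le ?_ hρ
    rw [mul_assoc C₃, ← mul_assoc]
    exact mul_lt_mul_of_pos_right hC₃ hsR
  obtain ⟨t0, ht0, v, w, hv, hw, hl0, hsig⟩ := Set.mem_iUnion₂.1 hθ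
  obtain ⟨ht1, ht2⟩ := Finset.mem_Icc.1 ht0
  obtain ⟨k, hk, hk1, hk2, hk3⟩ := exists_scale ht1 ht2
  set d : Fin p → ℝ := fun j => v j - w j with hd
  have hD0 : 0 ≤ ∑ j, d j ^ 2 := Finset.sum_nonneg fun j _ => sq_nonneg _
  have hsig2 : ρ ^ 2 ≤ 2 * 2 ^ k * ∑ j, d j ^ 2 :=
    hsig.trans (mul_le_mul_of_nonneg_right hk3 hD0)
  have hx : ∀ E, (fun q => halfDiff p n q (θ + E)) =
      fun q => halfDiff p n q θ + halfDiff p n q E := fun E => funext fun q => halfDiff_add ..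
  have hpow : 2 ^ k ≤ n / 2 :=
    (Nat.pow_le_pow_right (by norm_num) hk).trans (Nat.pow_log_le_self 2 (by omega))
  have hu : ∀ i < 2 ^ k, ∀ j, halfDiff p n (i, j) θ = d j / √2 := fun i hi' j =>
    halfDiff_of_mem_ThetaAt hv hw (by omega) (by omega) (by omega) j
  have hrej : ∀ E, (C₂ * (s * R) < firstStat a (fun q => halfDiff p n q θ + halfDiff p n q E) ∨
        ∃ k ∈ Finset.range (Nat.log 2 (n / 2)),
          C₂ * (√s * ((min (2 ^ (k + 1)) (DeltaSparse n) / 2 : ℕ) : ℝ)) <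
          momStat (2 ^ k) (m k) (min (2 ^ (k + 1)) (DeltaSparse n) / 2) a
            (fun q => halfDiff p n q θ + halfDiff p n q E)) →
      phiPsparseMoM p n s α C₁ C₂ (θ + E) = 1 := by
    intro E hE
    rw [← hx] at hE
    exact if_pos ((exists_grid_iff hn hs1 hsp hC₂ m
      (fun k => ⟨hm1 k, hG k, hGm k⟩) (θ + E)).2 hE)
  have hphi : ∀ E, 1 - phiPsparseMoM p n s α C₁ C₂ (θ + E) =
      if phiPsparseMoM p n s α C₁ C₂ (θ + E) ≠ 1 then 1 else 0 := by
    intro E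
    rcases phiPsparseMoM_eq_zero_or_one p n s α C₁ C₂ (θ + E) with e | e <;> rw [e] <;> norm_num
  simp_rw [hphi]
  rcases k with _ | k
  · refine (integral_ite_le_measureReal P _
      {E | firstStat a (fun q => halfDiff p n q θ + halfDiff p n q E) ≤ C₂ * (s * R)}
      fun E hE => ?_).trans ((measureReal_firstStat_le_le hα (hst 0 (by omega)) (d := d) hs1 ha hL₀
        (fun j => hu 0 (by norm_num) j) hl0 ?_).trans ?_)
    · by_contra h
      rw [Set.mem_ofPred_eq, not_le] at h
      exact hE (hrej E (Or.inl h))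
    · rw [pow_zero, mul_one] at hsig2
      have h1 : L₀ * s ≤ L₀ * (s * (R + LL n)) := by gcongr; nlinarith
      have h2 : C₂ * (s * R) ≤ C₂ * (s * (R + LL n)) := by gcongr; linarith
      nlinarith [mul_pos hC₂ hsR, mul_pos hL₀ hsR]
    · gcongr; norm_num
  · set G := min (2 ^ (k + 1)) (DeltaSparse n) / 2 with hG_def
    have hN1 : 1 ≤ 2 ^ k := Nat.one_le_two_pow
    have hpow2 : 2 * 2 ^ k ≤ n / 2 := by rwa [← pow_succ']
    refine (integral_ite_le_measureReal P _
      {E | momStat (2 ^ k) (m k) G a (fun q => halfDiff p n q θ + halfDiff p n q E) ≤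
        C₂ * √s * G} fun E hE => ?_).trans
      (measureReal_momStat_le_le hα hM (measurable_halfDiff p n) hi hst (hm1 k) (hG k) (hGm k)
        hpow2 hs1 (by linarith) hL₀ (d := d) (fun i hi' j => hu i (by rwa [pow_succ']) j) hl0 ?_ ?_)
    · by_contra h
      rw [Set.mem_ofPred_eq, not_le] at h
      exact hE (hrej E (Or.inr ⟨k, Finset.mem_range.2 hk, by rwa [← mul_assoc]⟩))
    · exact mul_tailBound_le hs1 hN1 hM (by linarith) (by linarith) hδ1 hδ
        (hC p s (2 ^ k) (LL n) hs1 hsp hN1 (by linarith))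
    · have h1 : L₀ * s ≤ L₀ * (s * (R + LL n)) := by gcongr; nlinarith
      have h2 : G * (C₂ * √s + s + 3 * L₀ * s) ≤
          16 * (C₂ + 1 + 3 * L₀) * (s * (R + LL n)) := by
        calc (G : ℝ) * (C₂ * √s + s + 3 * L₀ * s)
            ≤ (16 * LL n) * (C₂ * s + s + 3 * L₀ * s) := by gcongr; exact hGle k
          _ = 16 * (C₂ + 1 + 3 * L₀) * (s * LL n) := by ring
          _ ≤ _ := by gcongr; linarith
      rw [pow_succ (2 : ℝ) k] at hsig2
      push_cast
      linarith

/-- Proposition: sparse median-of-means testing under finite-moment noise. -/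
theorem statement_5 (α K ε : ℝ) (hα : 4 ≤ α) (hK : 0 < K) (hε0 : 0 < ε) (hε1 : ε < 1) :
    ∃ C₁ C₂ C₃ : ℝ, 0 < C₁ ∧ 0 < C₂ ∧ 0 < C₃ ∧
      ∀ p n s : ℕ, 0 < p → 2 ≤ n → 1 ≤ s → s ≤ p → ∀ ρ : ℝ,
        C₃ * (s : ℝ) * (((p : ℝ) / (s : ℝ)) ^ ((2 : ℝ) / α) + LL n) ≤ ρ ^ 2 →
        risk p n (Pclass p n α K) (Theta1 p n s ρ) (phiPsparseMoM p n s α C₁ C₂) ≤ ε := by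
  have hM : 0 < 2 ^ α * (K ^ α + K ^ α) := by positivity
  obtain ⟨C₁, hC₁, hC⟩ := exists_level_const α (2 ^ α * (K ^ α + K ^ α)) (ε / 64) hα hM (by positivity)
  set M := 2 ^ α * (K ^ α + K ^ α) with hM_def
  set C₂ := 2 * √(4 + M) / (ε / 32) + 8 * M / ε with hC₂_def
  have hC₂ : 0 < C₂ := by positivity
  have hC₂' : 2 * √(4 + M) / (ε / 32) ≤ C₂ := le_add_of_nonneg_right (by positivity)
  have hMC : M / C₂ ≤ ε / 8 := by
    have h : 8 * M / ε ≤ C₂ := le_add_of_nonneg_left (by positivity)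
    rw [div_le_iff₀ hε0] at h
    rw [div_le_iff₀ hC₂]
    linarith
  refine ⟨C₁, C₂, 16 * (2 * C₁ ^ 2 + 8 / ε + 16 * (C₂ + 1 + 3 * (8 / ε))) + 1, by linarith, hC₂,
    by positivity, fun p n s _ hn hs hsp ρ hρ => ?_⟩
  have h1 : (⨆ P ∈ Pclass p n α K, ⨆ θ ∈ Theta0 p n,
      ∫ E, phiPsparseMoM p n s α C₁ C₂ (θ + E) ∂P) ≤ ε / 2 :=
    iSup_mem_le_of_le (by positivity) fun P hP => iSup_mem_le_of_le (by positivity) fun θ hθ =>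
      (type_one_error_le hα hK hn hs hsp (by positivity) (by linarith) (by positivity)
        (by linarith) hC₁ hC hC₂' hP hθ).trans (by linarith)
  have h2 : (⨆ P ∈ Pclass p n α K, ⨆ θ ∈ Theta1 p n s ρ,
      ∫ E, (1 - phiPsparseMoM p n s α C₁ C₂ (θ + E)) ∂P) ≤ ε / 2 :=
    iSup_mem_le_of_le (by positivity) fun P hP => iSup_mem_le_of_le (by positivity) fun θ hθ =>
      (type_two_error_le hα hK hn hs hsp (by linarith) (by positivity) hC₁ hC hC₂
        (by positivity) (lt_add_one _) hρ hP hθ).trans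
          (by rw [div_div_eq_mul_div]; linarith)
  rw [risk]
  linarith

end ChangePoint
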